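/- Let 0 < α < β < 1. The skew product S admits a unique S-invariant probability measure ν on I × I that is absolutely continuous with respect to m × m; moreover its density h (with respect to m × m) has a version that is Lipschitz on every compact subset of (0,1] × [0,1]. -/

import Mathlib

open MeasureTheory Filter Set Topology

noncomputable section

/-- The Liverani–Saussol–Vaienti map `T_a` on `[0,1]`. -/
def lsv (a x : ℝ) : ℝ := if x ≤ 1 / 2 then x * (1 + (2 : ℝ) ^ a * x ^ a) else 2 * x - 1

/-- Random parameter selection: `α` on `[0,p₁)`, `β` on `[p₁,1]`. -/
def alphaOf (α β p₁ ω : ℝ) : ℝ := if ω < p₁ then α else β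

/-- The noise dynamics `φ` on `[0,1]`. -/
def phiMap (p₁ ω : ℝ) : ℝ := if ω < p₁ then ω / p₁ else (ω - p₁) / (1 - p₁)

/-- The skew product `S(x,ω) = (T_{α(ω)} x, φ ω)`. -/
def skewLSV (α β p₁ : ℝ) (p : ℝ × ℝ) : ℝ × ℝ :=
  (lsv (alphaOf α β p₁ p.2) p.1, phiMap p₁ p.2)

/-- The base of inducing, `Δ₀ = (1/2,1] × [0,1]`. -/
def Δ0 : Set (ℝ × ℝ) := Ioc (1 / 2 : ℝ) 1 ×ˢ Icc (0 : ℝ) 1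

/-- A branch of the LSV map, extended to a homeomorphism of the line. -/
def leftExt (a y : ℝ) : ℝ := y + (2 * max y 0) ^ a * max y 0

lemma leftExt_strictMono {a : ℝ} (ha : 0 < a) : StrictMono (leftExt a) := by
  intro y z hyz
  have h : max y 0 ≤ max z 0 := max_le_max_right 0 hyz.le
  have h0 : (0 : ℝ) ≤ max y 0 := le_max_right _ _
  have : (2 * max y 0) ^ a * max y 0 ≤ (2 * max z 0) ^ a * max z 0 := by gcongr
  simp only [leftExt]
  linarith

lemma leftExt_sub_ge {a y z : ℝ} (ha : 0 < a) (hyz : y ≤ z) :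
    z - y ≤ leftExt a z - leftExt a y := by
  have h : max y 0 ≤ max z 0 := max_le_max_right 0 hyz
  have h0 : (0 : ℝ) ≤ max y 0 := le_max_right _ _
  have : (2 * max y 0) ^ a * max y 0 ≤ (2 * max z 0) ^ a * max z 0 := by gcongr
  simp only [leftExt]
  linarith

lemma leftExt_surjective {a : ℝ} (ha : 0 < a) : Function.Surjective (leftExt a) := by
  have hc : Continuous (leftExt a) := by
    unfold leftExt
    have : Continuous fun y : ℝ => (2 * max y 0) ^ a :=
      Continuous.rpow_const (by fun_prop) (fun _ => Or.inr ha.le)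
    fun_prop
  refine hc.surjective ?_ ?_
  · refine tendsto_atTop_mono (fun y => ?_) tendsto_id
    have : (0 : ℝ) ≤ max y 0 := le_max_right _ _
    have : 0 ≤ (2 * max y 0) ^ a * max y 0 := by positivity
    simp only [leftExt, id]
    linarith
  · refine tendsto_id.congr' ?_
    filter_upwards [eventually_le_atBot (0 : ℝ)] with y hy
    simp [leftExt, hy]

/-- The inverse of the neutral branch of the LSV map. -/
def leftInv (a : ℝ) : ℝ → ℝ := Function.invFun (leftExt a)

/-- The derivative of the inverse of the neutral branch. -/
def leftWeight (a x : ℝ) : ℝ := (1 + (1 + a) * (2 * leftInv a x) ^ a)⁻¹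

lemma leftExt_leftInv {a : ℝ} (ha : 0 < a) (x : ℝ) : leftExt a (leftInv a x) = x :=
  Function.rightInverse_invFun (leftExt_surjective ha) x

lemma leftInv_leftExt {a : ℝ} (ha : 0 < a) (y : ℝ) : leftInv a (leftExt a y) = y :=
  Function.leftInverse_invFun (leftExt_strictMono ha).injective y

lemma leftInv_strictMono {a : ℝ} (ha : 0 < a) : StrictMono (leftInv a) := fun x z hxz => by
  rw [← (leftExt_strictMono ha).lt_iff_lt, leftExt_leftInv ha, leftExt_leftInv ha]
  exact hxz

lemma leftExt_zero (a : ℝ) : leftExt a 0 = 0 := by simp [leftExt]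

lemma leftExt_half (a : ℝ) : leftExt a (1 / 2) = 1 := by
  norm_num [leftExt]

lemma leftInv_mem {a x : ℝ} (ha : 0 < a) (hx : x ∈ Ioc (0 : ℝ) 1) :
    leftInv a x ∈ Ioc (0 : ℝ) (1 / 2) := by
  constructor
  · rw [← (leftExt_strictMono ha).lt_iff_lt, leftExt_leftInv ha, leftExt_zero]
    exact hx.1
  · rw [← (leftExt_strictMono ha).le_iff_le, leftExt_leftInv ha, leftExt_half]
    exact hx.2

lemma leftExt_image {a : ℝ} (ha : 0 < a) :
    leftExt a '' Ioc 0 (1 / 2) = Ioc 0 1 := by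
  ext x
  constructor
  · rintro ⟨y, hy, rfl⟩
    rw [← leftExt_zero a, ← leftExt_half a]
    exact ⟨leftExt_strictMono ha hy.1, (leftExt_strictMono ha).monotone hy.2⟩
  · exact fun hx => ⟨leftInv a x, leftInv_mem ha hx, leftExt_leftInv ha x⟩

lemma leftExt_of_pos {a y : ℝ} (hy : 0 < y) : leftExt a y = y * (1 + (2 * y) ^ a) := by
  simp only [leftExt, max_eq_left hy.le]
  ring

lemma leftInv_eq {a x : ℝ} (ha : 0 < a) (hx : x ∈ Ioc (0 : ℝ) 1) :
    x = leftInv a x * (1 + (2 * leftInv a x) ^ a) := by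
  rw [← leftExt_of_pos (leftInv_mem ha hx).1, leftExt_leftInv ha]

lemma hasDerivAt_leftExt {a y : ℝ} (hy : 0 < y) :
    HasDerivAt (leftExt a) (1 + (1 + a) * (2 * y) ^ a) y := by
  have h1 : HasDerivAt (fun z : ℝ => z * (1 + (2 * z) ^ a))
      (1 * (1 + (2 * y) ^ a) + y * (2 * 1 * a * (2 * y) ^ (a - 1))) y := by
    refine (hasDerivAt_id y).mul (HasDerivAt.const_add 1 ?_)
    exact ((hasDerivAt_id y).const_mul 2).rpow_const (Or.inl (by simp [hy.ne']))
  have h2 : (2 * y) ^ a = (2 * y) ^ (a - 1) * (2 * y) := by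
    rw [← Real.rpow_add_one (by positivity)]
    ring_nf
  have h3 : 1 * (1 + (2 * y) ^ a) + y * (2 * 1 * a * (2 * y) ^ (a - 1))
      = 1 + (1 + a) * (2 * y) ^ a := by
    rw [h2]
    ring
  rw [h3] at h1
  refine h1.congr_of_eventuallyEq ?_
  filter_upwards [lt_mem_nhds hy] with z hz using leftExt_of_pos hz

lemma leftWeight_nonneg {a x : ℝ} (ha : 0 < a) (hx : x ∈ Ioc (0 : ℝ) 1) :
    0 ≤ leftWeight a x := by
  have := (leftInv_mem ha hx).1
  unfold leftWeight
  positivity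

lemma lintegral_leftInv {a : ℝ} (ha : 0 < a) (g : ℝ → ENNReal) :
    ∫⁻ x in Ioc 0 1, ENNReal.ofReal (leftWeight a x) * g (leftInv a x)
      = ∫⁻ x in Ioc 0 (1 / 2), g x := by
  rw [← leftExt_image ha, lintegral_image_eq_lintegral_abs_deriv_mul measurableSet_Ioc
    (fun y hy => (hasDerivAt_leftExt hy.1).hasDerivWithinAt)
    (leftExt_strictMono ha).injective.injOn]
  refine setLIntegral_congr_fun measurableSet_Ioc fun y hy => ?_
  have hy0 := hy.1
  have : 0 < 1 + (1 + a) * (2 * y) ^ a := by positivity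
  rw [leftWeight, leftInv_leftExt ha, ← mul_assoc, ← ENNReal.ofReal_mul (abs_nonneg _),
    abs_of_pos this, mul_inv_cancel₀ this.ne', ENNReal.ofReal_one, one_mul]

lemma lintegral_rightInv (g : ℝ → ENNReal) :
    ∫⁻ x in Ioc 0 1, ENNReal.ofReal (1 / 2) * g ((x + 1) / 2)
      = ∫⁻ x in Ioc (1 / 2) 1, g x := by
  have himg : (fun x : ℝ => (x + 1) / 2) '' Ioc 0 1 = Ioc (1 / 2) 1 := by
    ext x
    constructor
    · rintro ⟨y, hy, rfl⟩
      exact ⟨by linarith [hy.1], by linarith [hy.2]⟩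
    · exact fun hx => ⟨2 * x - 1, ⟨by linarith [hx.1], by linarith [hx.2]⟩, by ring⟩
  rw [← himg, lintegral_image_eq_lintegral_abs_deriv_mul measurableSet_Ioc
    (f := fun x : ℝ => (x + 1) / 2) (f' := fun _ => 1 / 2)
    (fun y _ => (((hasDerivAt_id y).add_const 1).div_const 2).hasDerivWithinAt)
    (fun x _ y _ h => by simp only at h; linarith)]
  simp

lemma lintegral_affine {c q : ℝ} (hq : 0 < q) (g : ℝ → ENNReal) :
    ∫⁻ x in Ico 0 1, ENNReal.ofReal q * g (c + q * x) = ∫⁻ x in Ico c (c + q), g x := by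
  have himg : (fun x : ℝ => c + q * x) '' Ico 0 1 = Ico c (c + q) := by
    ext x
    constructor
    · rintro ⟨y, hy, rfl⟩
      exact ⟨by nlinarith [hy.1], by nlinarith [hy.2]⟩
    · refine fun hx => ⟨(x - c) / q, ⟨div_nonneg (by linarith [hx.1]) hq.le, ?_⟩, ?_⟩
      · rw [div_lt_one hq]; linarith [hx.2]
      · field_simp
        ring
  rw [← himg, lintegral_image_eq_lintegral_abs_deriv_mul measurableSet_Ico
    (f' := fun _ => q)
    (fun y _ => by
      simpa using (((hasDerivAt_id y).const_mul q).const_add c).hasDerivWithinAt)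
    (fun x _ y _ h => by simpa [hq.ne'] using h)]
  simp [abs_of_pos hq]

/-- The distortion factor between the points `x` and `x'`. -/
def distFactor (β x x' : ℝ) : ℝ := max 1 ((x' / x) ^ (β + 1))

lemma distFactor_of_ge {β x x' : ℝ} (hβ : 0 < β) (hx' : 0 < x') (h : x' ≤ x) :
    distFactor β x x' = 1 :=
  max_eq_left (Real.rpow_le_one (div_nonneg hx'.le (hx'.le.trans h))
    (div_le_one_of_le₀ h (hx'.le.trans h)) (by linarith))

lemma distFactor_of_le {β x x' : ℝ} (hβ : 0 < β) (hx : 0 < x) (h : x ≤ x') :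
    distFactor β x x' = (x' / x) ^ (β + 1) :=
  max_eq_right (Real.one_le_rpow ((one_le_div hx).2 h) (by linarith))

lemma distFactor_pos (β x x' : ℝ) : 0 < distFactor β x x' :=
  lt_of_lt_of_le one_pos (le_max_left _ _)

lemma neutral_distortion {a β s t : ℝ} (ha : 0 < a) (hab : a ≤ β) (hs : 0 ≤ s) (hst : s ≤ t) :
    (1 + s) ^ (β + 1) * (1 + (1 + a) * t) ≤ (1 + t) ^ (β + 1) * (1 + (1 + a) * s) := by
  set r := (t - s) / (1 + s) with hr
  have hs1 : 0 < 1 + s := by linarith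
  have hr0 : 0 ≤ r := div_nonneg (by linarith) hs1.le
  have ht : 1 + t = (1 + s) * (1 + r) := by
    rw [hr]; field_simp; ring
  have ht' : t = s + r * (1 + s) := by linarith
  have hB := one_add_mul_self_le_rpow_one_add (by linarith : -1 ≤ r) (by linarith : 1 ≤ β + 1)
  rw [ht, Real.mul_rpow hs1.le (by linarith), mul_assoc]
  refine mul_le_mul_of_nonneg_left ?_ (by positivity)
  have h1 : 0 ≤ 1 + (1 + a) * s := by positivity
  refine le_trans ?_ (mul_le_mul_of_nonneg_right hB h1)
  rw [ht']
  have : 0 ≤ r * ((β - a) + (1 + a) * s * β) := by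
    have := sub_nonneg.2 hab
    have : 0 ≤ β := by linarith
    positivity
  nlinarith

/-- The data of an inverse branch in the space direction, with range `J`, inverse map `u`,
Jacobian `w` and contraction rate `θ`. -/
structure InvBranch (β θ : ℝ) (J : Set ℝ) (u w : ℝ → ℝ) : Prop where
  subset : J ⊆ Ioc 0 1
  measurable_u : Measurable u
  measurable_w : Measurable w
  w_nonneg : ∀ x ∈ Ioc (0 : ℝ) 1, 0 ≤ w x
  mem : ∀ x ∈ Ioc (0 : ℝ) 1, u x ∈ J
  contract : ∀ x x' : ℝ, |u x - u x'| ≤ θ * |x - x'|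
  distortion : ∀ x ∈ Ioc (0 : ℝ) 1, ∀ x' ∈ Ioc (0 : ℝ) 1,
    w x * distFactor β (u x) (u x') ≤ distFactor β x x' * w x'
  change : ∀ g : ℝ → ENNReal,
    ∫⁻ x in Ioc 0 1, ENNReal.ofReal (w x) * g (u x) = ∫⁻ x in J, g x

lemma invBranch_left {a β : ℝ} (ha : 0 < a) (hab : a ≤ β) :
    InvBranch β 1 (Ioc 0 (1 / 2)) (leftInv a) (leftWeight a) where
  subset := Ioc_subset_Ioc_right (by norm_num)
  measurable_u := (leftInv_strictMono ha).monotone.measurable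
  measurable_w := by
    have := (leftInv_strictMono ha).monotone.measurable
    unfold leftWeight
    fun_prop
  w_nonneg x hx := leftWeight_nonneg ha hx
  mem x hx := leftInv_mem ha hx
  contract := by
    have key : ∀ x x' : ℝ, x ≤ x' → |leftInv a x - leftInv a x'| ≤ 1 * |x - x'| := by
      intro x x' h
      have h1 := (leftInv_strictMono ha).monotone h
      have h2 := leftExt_sub_ge ha h1
      rw [leftExt_leftInv ha, leftExt_leftInv ha] at h2
      rw [abs_sub_comm, abs_of_nonneg (sub_nonneg.2 h1), abs_sub_comm,
        abs_of_nonneg (sub_nonneg.2 h)]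
      linarith
    intro x x'
    rcases le_total x x' with h | h
    · exact key x x' h
    · rw [abs_sub_comm, abs_sub_comm x]
      exact key x' x h
  distortion := by
    intro x hx x' hx'
    have hβ : 0 < β := by linarith
    have hy := (leftInv_mem ha hx).1
    have hy' := (leftInv_mem ha hx').1
    have ex := leftInv_eq ha hx
    have ex' := leftInv_eq ha hx'
    rcases le_total x' x with h | h
    · have h1 := (leftInv_strictMono ha).monotone h
      rw [distFactor_of_ge hβ hy' h1, distFactor_of_ge hβ hx'.1 h, mul_one, one_mul]
      unfold leftWeight
      gcongr
    · have h1 := (leftInv_strictMono ha).monotone h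
      rw [distFactor_of_le hβ hy h1, distFactor_of_le hβ hx.1 h]
      unfold leftWeight
      set y := leftInv a x
      set y' := leftInv a x'
      set s := (2 * y) ^ a
      set t := (2 * y') ^ a
      have hs : 0 ≤ s := by positivity
      have ht : 0 ≤ t := by positivity
      have hst : s ≤ t := by simp only [s, t]; gcongr
      have hd := neutral_distortion ha hab hs hst
      have e : x' / x = (y' / y) * ((1 + t) / (1 + s)) := by
        rw [ex, ex']
        field_simp
      rw [e, Real.mul_rpow (by positivity) (by positivity), Real.div_rpow (by positivity)
        (by positivity) (β + 1) (x := 1 + t), mul_comm, mul_assoc]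
      refine mul_le_mul_of_nonneg_left ?_ (by positivity)
      rw [← div_eq_mul_inv, div_div, inv_eq_one_div, div_le_div_iff₀ (by positivity) (by positivity)]
      linarith
  change := lintegral_leftInv ha

lemma invBranch_right {β : ℝ} (hβ : 0 < β) :
    InvBranch β (1 / 2) (Ioc (1 / 2) 1) (fun x => (x + 1) / 2) (fun _ => 1 / 2) where
  subset := Ioc_subset_Ioc_left (by norm_num)
  measurable_u := by fun_prop
  measurable_w := by fun_prop
  w_nonneg x hx := by norm_num
  mem x hx := ⟨by linarith [hx.1], by linarith [hx.2]⟩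
  contract x x' := by
    rw [show (x + 1) / 2 - (x' + 1) / 2 = (1 / 2) * (x - x') by ring, abs_mul]
    norm_num
  distortion := by
    intro x hx x' hx'
    have h0 := hx.1
    have h0' := hx'.1
    rw [mul_comm]
    refine mul_le_mul_of_nonneg_right ?_ (by norm_num)
    rcases le_total x' x with h | h
    · rw [distFactor_of_ge hβ (by positivity) (by linarith), distFactor_of_ge hβ h0' h]
    · rw [distFactor_of_le hβ (by positivity) (by linarith), distFactor_of_le hβ h0 h]
      refine Real.rpow_le_rpow (by positivity) ?_ (by linarith)
      rw [div_le_div_iff₀ (by positivity) (by positivity)]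
      nlinarith
  change := lintegral_rightInv

lemma power_bound_step {a β x : ℝ} (ha : 0 < a) (hab : a ≤ β) (hβ : β < 1)
    (hx : x ∈ Ioc (0 : ℝ) 1) :
    leftWeight a x * (6 / (1 - β) * leftInv a x ^ (-β)) + 2 ^ β ≤ 6 / (1 - β) * x ^ (-β) := by
  have hy := (leftInv_mem ha hx).1
  have hy2 := (leftInv_mem ha hx).2
  have ex := leftInv_eq ha hx
  unfold leftWeight
  set y := leftInv a x
  set s := (2 * y) ^ a with hs_def
  have hβ0 : 0 < β := by linarith
  have hs : 0 < s := by positivity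
  have hs1 : s ≤ 1 := Real.rpow_le_one (by positivity) (by linarith) ha.le
  have hx0 := hx.1
  have hxs : x ^ β ≤ s := by
    calc x ^ β ≤ (2 * y) ^ β := by
          refine Real.rpow_le_rpow hx0.le ?_ hβ0.le
          rw [ex]; nlinarith
      _ ≤ s := Real.rpow_le_rpow_of_exponent_ge (by positivity) (by linarith) hab
  have hB : (1 + s) ^ β ≤ 1 + β * s :=
    rpow_one_add_le_one_add_mul_self (by linarith) hβ0.le hβ.le
  have h2 : (2 : ℝ) ^ β ≤ 2 := by
    simpa using Real.rpow_le_rpow_of_exponent_le (by norm_num : (1 : ℝ) ≤ 2) hβ.le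
  have hA : 6 ≤ 6 / (1 - β) * (1 + a - β) := by
    rw [div_mul_eq_mul_div, le_div_iff₀ (by linarith)]
    nlinarith
  have hA0 : 0 < 6 / (1 - β) := div_pos (by norm_num) (by linarith)
  set A := 6 / (1 - β)
  have hxb : 0 < x ^ β := by positivity
  have e1 : x ^ β = y ^ β * (1 + s) ^ β := by
    conv_lhs => rw [ex]
    rw [Real.mul_rpow hy.le (by positivity)]
  have hyb : 0 < y ^ β := by positivity
  have e2 : y ^ (-β) * x ^ β = (1 + s) ^ β := by
    rw [e1, Real.rpow_neg hy.le]
    field_simp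
  have e3 : x ^ (-β) * x ^ β = 1 := by
    rw [Real.rpow_neg hx0.le]
    field_simp
  have hw : 0 < 1 + (1 + a) * s := by positivity
  refine le_of_mul_le_mul_right ?_ hxb
  rw [add_mul, mul_assoc A, e3, mul_one, mul_assoc, mul_assoc, e2]
  have hle : (1 + (1 + a) * s)⁻¹ * (A * (1 + s) ^ β)
      ≤ (1 + (1 + a) * s)⁻¹ * (A * (1 + β * s)) := by gcongr
  have hle2 : 2 ^ β * x ^ β ≤ 2 * s := by gcongr
  have hfin : (1 + (1 + a) * s)⁻¹ * (A * (1 + β * s)) + 2 * s ≤ A := by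
    rw [inv_mul_eq_div, div_add' _ _ _ hw.ne', div_le_iff₀ hw]
    have : 2 * (1 + (1 + a) * s) ≤ A * (1 + a - β) := by
      have : a < 1 := by linarith
      nlinarith
    nlinarith
  linarith

/-- A fundamental domain of the skew product, of full measure in the unit square. -/
def unitBox : Set (ℝ × ℝ) := Ioc (0 : ℝ) 1 ×ˢ Ico (0 : ℝ) 1

lemma measurableSet_unitBox : MeasurableSet unitBox := measurableSet_Ioc.prod measurableSet_Ico

lemma volume_unitBox : volume unitBox = 1 := by
  simp [unitBox, Measure.volume_eq_prod, Measure.prod_prod]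

/-- The transfer operator of one branch of the skew product. -/
def branchOp (u w : ℝ → ℝ) (c q : ℝ) (F : ℝ × ℝ → ENNReal) (p : ℝ × ℝ) : ENNReal :=
  ENNReal.ofReal (q * w p.1) * F (u p.1, c + q * p.2)

/-- The sum of the transfer operators of a branch of the first map and a branch of the second. -/
def pairOp (p₁ : ℝ) (u w u' w' : ℝ → ℝ) (F : ℝ × ℝ → ENNReal) (p : ℝ × ℝ) : ENNReal :=
  branchOp u w 0 p₁ F p + branchOp u' w' p₁ (1 - p₁) F p

/-- The part of the transfer operator coming from the neutral branches. -/
def leftOp (α β p₁ : ℝ) : (ℝ × ℝ → ENNReal) → ℝ × ℝ → ENNReal :=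
  pairOp p₁ (leftInv α) (leftWeight α) (leftInv β) (leftWeight β)

/-- The part of the transfer operator coming from the expanding branches. -/
def rightOp (p₁ : ℝ) : (ℝ × ℝ → ENNReal) → ℝ × ℝ → ENNReal :=
  pairOp p₁ (fun x => (x + 1) / 2) (fun _ => 1 / 2) (fun x => (x + 1) / 2) (fun _ => 1 / 2)

/-- The transfer operator of the skew product. -/
def transferOp (α β p₁ : ℝ) (F : ℝ × ℝ → ENNReal) (p : ℝ × ℝ) : ENNReal :=
  leftOp α β p₁ F p + rightOp p₁ F p

/-- Comparability of the values of `F`, up to the distortion of the neutral fixed point and up to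
exponentially Lipschitz errors. -/
def HasDistortion (β a b : ℝ) (F : ℝ × ℝ → ENNReal) : Prop :=
  ∀ p ∈ unitBox, ∀ p' ∈ unitBox, F p ≤ ENNReal.ofReal
    (Real.exp (a * |p.1 - p'.1| + b * |p.2 - p'.2|) * distFactor β p.1 p'.1) * F p'

lemma HasDistortion.add {β a b : ℝ} {F G : ℝ × ℝ → ENNReal} (hF : HasDistortion β a b F)
    (hG : HasDistortion β a b G) : HasDistortion β a b (fun p => F p + G p) := by
  intro p hp p' hp'
  rw [mul_add]
  exact add_le_add (hF p hp p' hp') (hG p hp p' hp')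

lemma HasDistortion.tsum {β a b : ℝ} {F : ℕ → ℝ × ℝ → ENNReal}
    (hF : ∀ j, HasDistortion β a b (F j)) : HasDistortion β a b (fun p => ∑' j, F j p) := by
  intro p hp p' hp'
  rw [← ENNReal.tsum_mul_left]
  exact ENNReal.tsum_le_tsum fun j => hF j p hp p' hp'

lemma HasDistortion.mono {β a b a' b' : ℝ} {F : ℝ × ℝ → ENNReal} (hF : HasDistortion β a b F)
    (ha : a ≤ a') (hb : b ≤ b') : HasDistortion β a' b' F := by
  intro p hp p' hp'
  refine (hF p hp p' hp').trans ?_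
  have := distFactor_pos β p.1 p'.1
  gcongr

section Branch

variable {β θ c q : ℝ} {J : Set ℝ} {u w : ℝ → ℝ} {F : ℝ × ℝ → ENNReal}

lemma branch_mem (hB : InvBranch β θ J u w) (hq : 0 < q) (hc : 0 ≤ c) (hcq : c + q ≤ 1)
    {p : ℝ × ℝ} (hp : p ∈ unitBox) : (u p.1, c + q * p.2) ∈ unitBox := by
  obtain ⟨h1, h2, h3⟩ := hp
  refine ⟨hB.subset (hB.mem _ h1), ?_, ?_⟩
  · show 0 ≤ c + q * p.2
    positivity
  · show c + q * p.2 < 1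
    nlinarith

lemma HasDistortion.branch (hB : InvBranch β θ J u w) (hq : 0 < q) (hc : 0 ≤ c)
    (hcq : c + q ≤ 1) {a b ρ : ℝ} (hqρ : q ≤ ρ) (ha : 0 ≤ a) (hb : 0 ≤ b)
    (hF : HasDistortion β a b F) : HasDistortion β (a * θ) (b * ρ) (branchOp u w c q F) := by
  intro p hp p' hp'
  have h := hF _ (branch_mem hB hq hc hcq hp) _ (branch_mem hB hq hc hcq hp')
  have hw := hB.w_nonneg _ hp.1
  have hw' := hB.w_nonneg _ hp'.1
  unfold branchOp
  refine (mul_le_mul_right h _).trans ?_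
  rw [← mul_assoc, ← mul_assoc]
  refine mul_le_mul_left ?_ _
  have hd := distFactor_pos β (u p.1) (u p'.1)
  have hd' := distFactor_pos β p.1 p'.1
  rw [← ENNReal.ofReal_mul (by positivity), ← ENNReal.ofReal_mul (by positivity)]
  refine ENNReal.ofReal_le_ofReal ?_
  have h1 : Real.exp (a * |u p.1 - u p'.1| + b * |c + q * p.2 - (c + q * p'.2)|)
      ≤ Real.exp (a * θ * |p.1 - p'.1| + b * ρ * |p.2 - p'.2|) := by
    have e : c + q * p.2 - (c + q * p'.2) = q * (p.2 - p'.2) := by ring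
    rw [e, abs_mul, abs_of_pos hq, mul_assoc a, mul_assoc b]
    have := hB.contract p.1 p'.1
    gcongr
  have h2 := hB.distortion _ hp.1 _ hp'.1
  set E := Real.exp (a * |u p.1 - u p'.1| + b * |c + q * p.2 - (c + q * p'.2)|)
  set E' := Real.exp (a * θ * |p.1 - p'.1| + b * ρ * |p.2 - p'.2|)
  have hE : 0 < E := Real.exp_pos _
  calc q * w p.1 * (E * distFactor β (u p.1) (u p'.1))
      = q * E * (w p.1 * distFactor β (u p.1) (u p'.1)) := by ring
    _ ≤ q * E' * (distFactor β p.1 p'.1 * w p'.1) := by gcongr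
    _ = E' * distFactor β p.1 p'.1 * (q * w p'.1) := by ring

lemma measurable_branchOp (hB : InvBranch β θ J u w) (hF : Measurable F) :
    Measurable (branchOp u w c q F) := by
  have := hB.measurable_u
  have := hB.measurable_w
  unfold branchOp
  fun_prop

lemma lintegral_branchOp (hB : InvBranch β θ J u w) (hq : 0 < q) (hF : Measurable F) :
    ∫⁻ p in unitBox, branchOp u w c q F p = ∫⁻ p in J ×ˢ Ico c (c + q), F p := by
  rw [unitBox, Measure.volume_eq_prod,
    setLIntegral_prod _ (measurable_branchOp hB hF).aemeasurable,
    setLIntegral_prod _ hF.aemeasurable, ← hB.change]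
  refine setLIntegral_congr_fun measurableSet_Ioc fun x hx => ?_
  simp only [branchOp]
  rw [← lintegral_affine hq, ← lintegral_const_mul' _ _ ENNReal.ofReal_ne_top]
  refine lintegral_congr fun y => ?_
  rw [← mul_assoc, mul_comm q, ENNReal.ofReal_mul (hB.w_nonneg x hx)]

end Branch

section Pair

variable {β θ p₁ : ℝ} {J : Set ℝ} {u w u' w' : ℝ → ℝ} {F G : ℝ × ℝ → ENNReal}

lemma measurable_pairOp (hB : InvBranch β θ J u w) (hB' : InvBranch β θ J u' w')
    (hF : Measurable F) : Measurable (pairOp p₁ u w u' w' F) :=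
  (measurable_branchOp hB hF).add (measurable_branchOp hB' hF)

lemma lintegral_pairOp (hB : InvBranch β θ J u w) (hB' : InvBranch β θ J u' w')
    (h0 : 0 < p₁) (h1 : p₁ < 1) (hF : Measurable F) :
    ∫⁻ p in unitBox, pairOp p₁ u w u' w' F p = ∫⁻ p in J ×ˢ Ico 0 1, F p := by
  unfold pairOp
  rw [lintegral_add_left (measurable_branchOp hB hF), lintegral_branchOp hB h0 hF,
    lintegral_branchOp hB' (sub_pos.2 h1) hF, Measure.volume_eq_prod,
    setLIntegral_prod _ hF.aemeasurable, setLIntegral_prod _ hF.aemeasurable,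
    setLIntegral_prod _ hF.aemeasurable, ← lintegral_add_left (by fun_prop)]
  refine lintegral_congr fun x => ?_
  rw [zero_add, add_sub_cancel, ← lintegral_union measurableSet_Ico,
    Ico_union_Ico_eq_Ico h0.le h1.le]
  rw [Set.disjoint_left]
  exact fun y hy hy' => absurd hy.2 (not_lt.2 hy'.1)

lemma HasDistortion.pair (hB : InvBranch β θ J u w) (hB' : InvBranch β θ J u' w')
    (h0 : 0 < p₁) (h1 : p₁ < 1) {a b : ℝ} (ha : 0 ≤ a) (hb : 0 ≤ b)
    (hF : HasDistortion β a b F) :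
    HasDistortion β (a * θ) (b * max p₁ (1 - p₁)) (pairOp p₁ u w u' w' F) :=
  (hF.branch hB h0 le_rfl (by linarith) (le_max_left _ _) ha hb).add
    (hF.branch hB' (sub_pos.2 h1) h0.le (by linarith) (le_max_right _ _) ha hb)

lemma pairOp_congr (hB : InvBranch β θ J u w) (hB' : InvBranch β θ J u' w')
    (h0 : 0 < p₁) (h1 : p₁ < 1) (h : EqOn F G unitBox) :
    EqOn (pairOp p₁ u w u' w' F) (pairOp p₁ u w u' w' G) unitBox := by
  intro p hp
  simp only [pairOp, branchOp]
  rw [h (branch_mem hB h0 le_rfl (by linarith) hp),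
    h (branch_mem hB' (sub_pos.2 h1) h0.le (by linarith) hp)]

lemma pairOp_add : pairOp p₁ u w u' w' (F + G) =
    pairOp p₁ u w u' w' F + pairOp p₁ u w u' w' G := by
  funext p
  simp only [pairOp, branchOp, Pi.add_apply]
  ring

lemma pairOp_finset_sum (s : Finset ℕ) (F : ℕ → ℝ × ℝ → ENNReal) (p : ℝ × ℝ) :
    pairOp p₁ u w u' w' (fun p => ∑ k ∈ s, F k p) p = ∑ k ∈ s, pairOp p₁ u w u' w' (F k) p := by
  simp only [pairOp, branchOp, Finset.mul_sum, Finset.sum_add_distrib]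

lemma pairOp_const_mul (c : ENNReal) (p : ℝ × ℝ) :
    pairOp p₁ u w u' w' (fun p => c * F p) p = c * pairOp p₁ u w u' w' F p := by
  simp only [pairOp, branchOp]
  ring

lemma pairOp_comp_mul {S : ℝ × ℝ → ℝ × ℝ}
    (hS : ∀ p ∈ unitBox, S (u p.1, 0 + p₁ * p.2) = p)
    (hS' : ∀ p ∈ unitBox, S (u' p.1, p₁ + (1 - p₁) * p.2) = p) :
    EqOn (pairOp p₁ u w u' w' (fun p => G (S p) * F p))
      (fun p => G p * pairOp p₁ u w u' w' F p) unitBox := by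
  intro p hp
  simp only [pairOp, branchOp]
  rw [hS p hp, hS' p hp]
  ring

lemma tendsto_pairOp (hB : InvBranch β θ J u w) (hB' : InvBranch β θ J u' w')
    (h0 : 0 < p₁) (h1 : p₁ < 1) {ι : Type*} {l : Filter ι} {Φ : ι → ℝ × ℝ → ENNReal}
    (h : ∀ p ∈ unitBox, Tendsto (fun i => Φ i p) l (𝓝 (F p))) :
    ∀ p ∈ unitBox, Tendsto (fun i => pairOp p₁ u w u' w' (Φ i) p) l
      (𝓝 (pairOp p₁ u w u' w' F p)) := by
  intro p hp
  refine Tendsto.add ?_ ?_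
  · exact ENNReal.Tendsto.const_mul (h _ (branch_mem hB h0 le_rfl (by linarith) hp))
      (Or.inr ENNReal.ofReal_ne_top)
  · exact ENNReal.Tendsto.const_mul
      (h _ (branch_mem hB' (sub_pos.2 h1) h0.le (by linarith) hp))
      (Or.inr ENNReal.ofReal_ne_top)

end Pair

section Skew

variable {α β p₁ : ℝ}

lemma skewLSV_left_fst (hα : 0 < α) (h0 : 0 < p₁) {p : ℝ × ℝ} (hp : p ∈ unitBox) :
    skewLSV α β p₁ (leftInv α p.1, 0 + p₁ * p.2) = p := by
  obtain ⟨hx, hω⟩ := hp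
  have hy := leftInv_mem hα hx
  have hlt : p₁ * p.2 < p₁ := by nlinarith [hω.2]
  have e := leftInv_eq hα hx
  rw [Real.mul_rpow (by norm_num) hy.1.le] at e
  simp only [skewLSV, alphaOf, phiMap, zero_add, if_pos hlt, lsv, if_pos hy.2, ← e]
  ext
  · rfl
  · simp [h0.ne']

lemma skewLSV_left_snd (hβ : 0 < β) (h1 : p₁ < 1) {p : ℝ × ℝ}
    (hp : p ∈ unitBox) : skewLSV α β p₁ (leftInv β p.1, p₁ + (1 - p₁) * p.2) = p := by
  obtain ⟨hx, hω⟩ := hp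
  have hy := leftInv_mem hβ hx
  have hlt : ¬ p₁ + (1 - p₁) * p.2 < p₁ := by nlinarith [hω.1]
  have e := leftInv_eq hβ hx
  rw [Real.mul_rpow (by norm_num) hy.1.le] at e
  simp only [skewLSV, alphaOf, phiMap, if_neg hlt, lsv, if_pos hy.2, ← e]
  ext
  · rfl
  · simp [(sub_pos.2 h1).ne']

lemma skewLSV_right_fst (h0 : 0 < p₁) {p : ℝ × ℝ} (hp : p ∈ unitBox) :
    skewLSV α β p₁ ((p.1 + 1) / 2, 0 + p₁ * p.2) = p := by
  obtain ⟨hx, hω⟩ := hp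
  have hlt : p₁ * p.2 < p₁ := by nlinarith [hω.2]
  have hy : ¬ (p.1 + 1) / 2 ≤ 1 / 2 := by linarith [hx.1]
  simp only [skewLSV, phiMap, zero_add, if_pos hlt, lsv, if_neg hy]
  ext
  · simp only; ring
  · simp [h0.ne']

lemma skewLSV_right_snd (h1 : p₁ < 1) {p : ℝ × ℝ} (hp : p ∈ unitBox) :
    skewLSV α β p₁ ((p.1 + 1) / 2, p₁ + (1 - p₁) * p.2) = p := by
  obtain ⟨hx, hω⟩ := hp
  have hlt : ¬ p₁ + (1 - p₁) * p.2 < p₁ := by nlinarith [hω.1]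
  have hy : ¬ (p.1 + 1) / 2 ≤ 1 / 2 := by linarith [hx.1]
  simp only [skewLSV, phiMap, if_neg hlt, lsv, if_neg hy]
  ext
  · simp only; ring
  · simp [(sub_pos.2 h1).ne']

lemma leftOp_comp_mul (hα : 0 < α) (hβ : 0 < β) (h0 : 0 < p₁) (h1 : p₁ < 1)
    (F G : ℝ × ℝ → ENNReal) :
    EqOn (leftOp α β p₁ (fun p => G (skewLSV α β p₁ p) * F p))
      (fun p => G p * leftOp α β p₁ F p) unitBox :=
  pairOp_comp_mul (fun _ hp => skewLSV_left_fst hα h0 hp) (fun _ hp => skewLSV_left_snd hβ h1 hp)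

lemma rightOp_comp_mul (α β : ℝ) (h0 : 0 < p₁) (h1 : p₁ < 1) (F G : ℝ × ℝ → ENNReal) :
    EqOn (rightOp p₁ (fun p => G (skewLSV α β p₁ p) * F p))
      (fun p => G p * rightOp p₁ F p) unitBox :=
  pairOp_comp_mul (fun _ hp => skewLSV_right_fst h0 hp) (fun _ hp => skewLSV_right_snd h1 hp)

lemma measurable_skewLSV : Measurable (skewLSV α β p₁) := by
  have h1 : Measurable (alphaOf α β p₁) :=
    Measurable.ite measurableSet_Iio measurable_const measurable_const
  have h2 : Measurable (phiMap p₁) :=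
    Measurable.ite measurableSet_Iio (by fun_prop) (by fun_prop)
  have h3 : Measurable fun q : ℝ × ℝ => lsv q.1 q.2 :=
    Measurable.ite (measurableSet_le (by fun_prop) (by fun_prop)) (by fun_prop) (by fun_prop)
  exact (h3.comp ((h1.comp measurable_snd).prodMk measurable_fst)).prodMk (h2.comp measurable_snd)

variable {F : ℝ × ℝ → ENNReal}

lemma measurable_leftOp (hα : 0 < α) (hαβ : α ≤ β) (hF : Measurable F) :
    Measurable (leftOp α β p₁ F) :=
  measurable_pairOp (invBranch_left hα hαβ) (invBranch_left (hα.trans_le hαβ) le_rfl) hF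

lemma measurable_rightOp (hF : Measurable F) : Measurable (rightOp p₁ F) :=
  measurable_pairOp (invBranch_right one_pos) (invBranch_right one_pos) hF

lemma lintegral_leftOp (hα : 0 < α) (hαβ : α ≤ β) (h0 : 0 < p₁) (h1 : p₁ < 1)
    (hF : Measurable F) :
    ∫⁻ p in unitBox, leftOp α β p₁ F p = ∫⁻ p in Ioc 0 (1 / 2) ×ˢ Ico 0 1, F p :=
  lintegral_pairOp (invBranch_left hα hαβ) (invBranch_left (hα.trans_le hαβ) le_rfl) h0 h1 hF

lemma lintegral_rightOp (h0 : 0 < p₁) (h1 : p₁ < 1) (hF : Measurable F) :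
    ∫⁻ p in unitBox, rightOp p₁ F p = ∫⁻ p in Ioc (1 / 2) 1 ×ˢ Ico 0 1, F p :=
  lintegral_pairOp (invBranch_right one_pos) (invBranch_right one_pos) h0 h1 hF

lemma lintegral_leftOp_add_rightOp (hα : 0 < α) (hαβ : α ≤ β) (h0 : 0 < p₁) (h1 : p₁ < 1)
    (hF : Measurable F) :
    (∫⁻ p in unitBox, leftOp α β p₁ F p) + ∫⁻ p in unitBox, rightOp p₁ F p
      = ∫⁻ p in unitBox, F p := by
  rw [lintegral_leftOp hα hαβ h0 h1 hF, lintegral_rightOp h0 h1 hF, unitBox,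
    ← lintegral_union (measurableSet_Ioc.prod measurableSet_Ico), ← union_prod,
    Ioc_union_Ioc_eq_Ioc (by norm_num) (by norm_num)]
  rw [Set.disjoint_left]
  exact fun y hy hy' => absurd hy.1.2 (not_le.2 hy'.1.1)

lemma lintegral_transferOp (hα : 0 < α) (hαβ : α ≤ β) (h0 : 0 < p₁) (h1 : p₁ < 1)
    (hF : Measurable F) :
    ∫⁻ p in unitBox, transferOp α β p₁ F p = ∫⁻ p in unitBox, F p := by
  rw [← lintegral_leftOp_add_rightOp hα hαβ h0 h1 hF,
    ← lintegral_add_left (measurable_leftOp hα hαβ hF)]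
  rfl

lemma HasDistortion.left (hα : 0 < α) (hαβ : α ≤ β) (h0 : 0 < p₁) (h1 : p₁ < 1) {a b : ℝ}
    (ha : 0 ≤ a) (hb : 0 ≤ b) (hF : HasDistortion β a b F) :
    HasDistortion β a (b * max p₁ (1 - p₁)) (leftOp α β p₁ F) := by
  have h := HasDistortion.pair (invBranch_left hα hαβ)
    (invBranch_left (hα.trans_le hαβ) le_rfl) h0 h1 ha hb hF
  rwa [mul_one] at h

lemma HasDistortion.right (hβ : 0 < β) (h0 : 0 < p₁) (h1 : p₁ < 1) {a b : ℝ}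
    (ha : 0 ≤ a) (hb : 0 ≤ b) (hF : HasDistortion β a b F) :
    HasDistortion β (a * (1 / 2)) (b * max p₁ (1 - p₁)) (rightOp p₁ F) :=
  HasDistortion.pair (invBranch_right hβ) (invBranch_right hβ) h0 h1 ha hb hF

end Skew

/-- The transfer operator of the map induced by first passage through the expanding branches. -/
def inducedOp (α β p₁ : ℝ) (F : ℝ × ℝ → ENNReal) (p : ℝ × ℝ) : ENNReal :=
  ∑' j : ℕ, rightOp p₁ ((leftOp α β p₁)^[j] F) p

section Induced

variable {α β p₁ : ℝ} {F : ℝ × ℝ → ENNReal}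

lemma measurable_leftOp_iterate (hα : 0 < α) (hαβ : α ≤ β) (hF : Measurable F) (n : ℕ) :
    Measurable ((leftOp α β p₁)^[n] F) := by
  induction n with
  | zero => exact hF
  | succ n ih =>
    rw [Function.iterate_succ_apply']
    exact measurable_leftOp hα hαβ ih

lemma measurable_inducedOp (hα : 0 < α) (hαβ : α ≤ β) (hF : Measurable F) :
    Measurable (inducedOp α β p₁ F) :=
  Measurable.tsum fun n => measurable_rightOp (measurable_leftOp_iterate hα hαβ hF n)

lemma leftOp_congr (hα : 0 < α) (hαβ : α ≤ β) (h0 : 0 < p₁) (h1 : p₁ < 1)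
    {F G : ℝ × ℝ → ENNReal} (h : EqOn F G unitBox) :
    EqOn (leftOp α β p₁ F) (leftOp α β p₁ G) unitBox :=
  pairOp_congr (invBranch_left hα hαβ) (invBranch_left (hα.trans_le hαβ) le_rfl) h0 h1 h

lemma rightOp_congr (h0 : 0 < p₁) (h1 : p₁ < 1)
    {F G : ℝ × ℝ → ENNReal} (h : EqOn F G unitBox) :
    EqOn (rightOp p₁ F) (rightOp p₁ G) unitBox :=
  pairOp_congr (invBranch_right one_pos) (invBranch_right one_pos) h0 h1 h

lemma leftOp_iterate_invariant_mul (hα : 0 < α) (hαβ : α ≤ β) (h0 : 0 < p₁) (h1 : p₁ < 1)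
    {G : ℝ × ℝ → ENNReal} (hG : ∀ p, G (skewLSV α β p₁ p) = G p) (n : ℕ) :
    EqOn ((leftOp α β p₁)^[n] (fun p => G p * F p))
      (fun p => G p * (leftOp α β p₁)^[n] F p) unitBox := by
  induction n with
  | zero => exact fun p _ => rfl
  | succ n ih =>
    rw [Function.iterate_succ_apply', Function.iterate_succ_apply']
    refine (leftOp_congr hα hαβ h0 h1 ih).trans ?_
    have h := leftOp_comp_mul hα (hα.trans_le hαβ) h0 h1 ((leftOp α β p₁)^[n] F) G
    simp only [hG] at h
    exact h

lemma inducedOp_invariant_mul (hα : 0 < α) (hαβ : α ≤ β) (h0 : 0 < p₁) (h1 : p₁ < 1)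
    {G : ℝ × ℝ → ENNReal} (hG : ∀ p, G (skewLSV α β p₁ p) = G p) :
    EqOn (inducedOp α β p₁ (fun p => G p * F p)) (fun p => G p * inducedOp α β p₁ F p)
      unitBox := by
  intro p hp
  simp only [inducedOp]
  rw [← ENNReal.tsum_mul_left]
  refine tsum_congr fun j => ?_
  rw [rightOp_congr h0 h1 (leftOp_iterate_invariant_mul hα hαβ h0 h1 hG j) hp]
  have h := rightOp_comp_mul α β h0 h1 ((leftOp α β p₁)^[j] F) G hp
  simp only [hG] at h
  exact h

lemma sum_lintegral_rightOp_iterate (hα : 0 < α) (hαβ : α ≤ β) (h0 : 0 < p₁) (h1 : p₁ < 1)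
    (hF : Measurable F) (n : ℕ) :
    (∑ j ∈ Finset.range n, ∫⁻ p in unitBox, rightOp p₁ ((leftOp α β p₁)^[j] F) p)
      + ∫⁻ p in unitBox, (leftOp α β p₁)^[n] F p = ∫⁻ p in unitBox, F p := by
  induction n with
  | zero => simp
  | succ n ih =>
    rw [← ih, Finset.sum_range_succ, Function.iterate_succ_apply', add_assoc,
      ← lintegral_leftOp_add_rightOp hα hαβ h0 h1 (measurable_leftOp_iterate hα hαβ hF n),
      add_comm (∫⁻ p in unitBox, leftOp α β p₁ _ p)]

lemma lintegral_leftOp_iterate_le (hα : 0 < α) (hαβ : α ≤ β) (h0 : 0 < p₁) (h1 : p₁ < 1)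
    (hF : Measurable F) (n : ℕ) :
    ∫⁻ p in unitBox, (leftOp α β p₁)^[n] F p ≤ ∫⁻ p in unitBox, F p := by
  rw [← sum_lintegral_rightOp_iterate hα hαβ h0 h1 hF n]
  exact le_add_self

lemma leftOp_iterate_add (n : ℕ) (F G : ℝ × ℝ → ENNReal) :
    (leftOp α β p₁)^[n] (F + G) = (leftOp α β p₁)^[n] F + (leftOp α β p₁)^[n] G := by
  induction n with
  | zero => rfl
  | succ n ih =>
    rw [Function.iterate_succ_apply', Function.iterate_succ_apply',
      Function.iterate_succ_apply', ih]
    exact pairOp_add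

lemma leftInv_lt_of_lt_mul {a β δ s x : ℝ} (ha : 0 < a) (hab : a ≤ β) (hδ : 0 < δ) (hs : δ ≤ s)
    (hx : x ∈ Ioc (0 : ℝ) 1) (h : x < s * (1 + (2 * δ) ^ β)) : leftInv a x < s := by
  by_contra! hle
  have hy := leftInv_mem ha hx
  have h1 : (2 * δ) ^ β ≤ (2 * leftInv a x) ^ a :=
    calc (2 * δ) ^ β ≤ (2 * leftInv a x) ^ β := by
          have : δ ≤ leftInv a x := hs.trans hle
          gcongr
          linarith
      _ ≤ (2 * leftInv a x) ^ a :=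
          Real.rpow_le_rpow_of_exponent_ge (by linarith [hy.1]) (by linarith [hy.2]) hab
  have e := leftInv_eq ha hx
  have : s * (1 + (2 * δ) ^ β) ≤ leftInv a x * (1 + (2 * leftInv a x) ^ a) := by
    have : 0 < s := hδ.trans_le hs
    have := hy.1
    gcongr
  linarith

lemma leftOp_iterate_eq_zero (hα : 0 < α) (hαβ : α ≤ β) (h0 : 0 < p₁) (h1 : p₁ < 1)
    {δ : ℝ} (hδ : 0 < δ) (hF : ∀ p ∈ unitBox, p.1 < δ → F p = 0) (n : ℕ) :
    ∀ p ∈ unitBox, p.1 < δ * (1 + (2 * δ) ^ β) ^ n → (leftOp α β p₁)^[n] F p = 0 := by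
  induction n with
  | zero => simpa using hF
  | succ n ih =>
    intro p hp hlt
    have hβ := hα.trans_le hαβ
    rw [pow_succ, ← mul_assoc] at hlt
    have hs : δ ≤ δ * (1 + (2 * δ) ^ β) ^ n := by
      refine le_mul_of_one_le_right hδ.le (one_le_pow₀ ?_)
      have : 0 ≤ (2 * δ) ^ β := by positivity
      linarith
    have e1 := ih _ (branch_mem (invBranch_left hα hαβ) h0 le_rfl (by linarith) hp)
      (leftInv_lt_of_lt_mul hα hαβ hδ hs hp.1 hlt)
    have e2 := ih _ (branch_mem (invBranch_left hβ le_rfl) (sub_pos.2 h1) h0.le (by linarith) hp)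
      (leftInv_lt_of_lt_mul hβ le_rfl hδ hs hp.1 hlt)
    rw [Function.iterate_succ_apply']
    simp only [leftOp, pairOp, branchOp] at e1 e2 ⊢
    rw [e1, e2]
    simp

lemma exists_strip_lintegral_lt (hF : ∫⁻ p in unitBox, F p ≠ ⊤) {ε : ENNReal} (hε : ε ≠ 0) :
    ∃ δ : ℝ, 0 < δ ∧ ∫⁻ p in unitBox, {p : ℝ × ℝ | p.1 < δ}.indicator F p < ε := by
  obtain ⟨η, hη, h⟩ := exists_pos_setLIntegral_lt_of_measure_lt hF hε
  obtain ⟨δ, hδ, hδη⟩ : ∃ δ : ℝ, 0 < δ ∧ ENNReal.ofReal δ < η := by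
    obtain ⟨r, hr0, hr⟩ := ENNReal.lt_iff_exists_real_btwn.1 hη
    refine ⟨r, ?_, hr.2⟩
    simpa using hr.1
  refine ⟨δ, hδ, ?_⟩
  rw [lintegral_indicator (measurableSet_lt measurable_fst measurable_const)]
  refine h _ (lt_of_le_of_lt ?_ hδη)
  rw [Measure.restrict_apply (measurableSet_lt measurable_fst measurable_const)]
  calc volume ({p : ℝ × ℝ | p.1 < δ} ∩ unitBox)
      ≤ volume (Icc (0 : ℝ) δ ×ˢ Icc (0 : ℝ) 1) :=
        measure_mono fun p hp => ⟨⟨hp.2.1.1.le, le_of_lt hp.1⟩, ⟨hp.2.2.1, hp.2.2.2.le⟩⟩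
    _ = ENNReal.ofReal δ := by
        rw [Measure.volume_eq_prod, Measure.prod_prod]
        simp

lemma exists_lintegral_leftOp_iterate_le (hα : 0 < α) (hαβ : α ≤ β) (h0 : 0 < p₁) (h1 : p₁ < 1)
    (hF : Measurable F) (hfin : ∫⁻ p in unitBox, F p ≠ ⊤) {ε : ENNReal} (hε : ε ≠ 0) :
    ∃ n, ∫⁻ p in unitBox, (leftOp α β p₁)^[n] F p ≤ ε := by
  obtain ⟨δ, hδ, hlt⟩ := exists_strip_lintegral_lt hfin hε
  have hms : MeasurableSet {p : ℝ × ℝ | p.1 < δ} := measurableSet_lt measurable_fst measurable_const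
  have hr : 1 < 1 + (2 * δ) ^ β := by
    have : 0 < (2 * δ) ^ β := by positivity
    linarith
  obtain ⟨n, hn⟩ := pow_unbounded_of_one_lt (1 / δ) hr
  rw [div_lt_iff₀' hδ] at hn
  refine ⟨n, ?_⟩
  rw [← indicator_self_add_compl {p : ℝ × ℝ | p.1 < δ} F, leftOp_iterate_add]
  calc _ = ∫⁻ p in unitBox, (leftOp α β p₁)^[n] ({p : ℝ × ℝ | p.1 < δ}.indicator F) p := by
        refine setLIntegral_congr_fun measurableSet_unitBox fun p hp => ?_
        have hzero : ∀ p ∈ unitBox, p.1 < δ → {p : ℝ × ℝ | p.1 < δ}ᶜ.indicator F p = 0 :=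
          fun p _ hp => by simp [hp]
        rw [Pi.add_apply, leftOp_iterate_eq_zero hα hαβ h0 h1 hδ hzero n p hp
          (hp.1.2.trans_lt hn), add_zero]
    _ ≤ _ := lintegral_leftOp_iterate_le hα hαβ h0 h1 (hF.indicator hms) n
    _ ≤ ε := hlt.le

lemma lintegral_inducedOp (hα : 0 < α) (hαβ : α ≤ β) (h0 : 0 < p₁) (h1 : p₁ < 1)
    (hF : Measurable F) (hfin : ∫⁻ p in unitBox, F p ≠ ⊤) :
    ∫⁻ p in unitBox, inducedOp α β p₁ F p = ∫⁻ p in unitBox, F p := by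
  unfold inducedOp
  rw [lintegral_tsum fun j =>
    (measurable_rightOp (measurable_leftOp_iterate hα hαβ hF j)).aemeasurable]
  refine le_antisymm ?_ ?_
  · rw [ENNReal.tsum_eq_iSup_nat]
    refine iSup_le fun n => ?_
    rw [← sum_lintegral_rightOp_iterate hα hαβ h0 h1 hF n]
    exact le_self_add
  · refine ENNReal.le_of_forall_pos_le_add fun ε hε _ => ?_
    obtain ⟨n, hn⟩ := exists_lintegral_leftOp_iterate_le hα hαβ h0 h1 hF hfin
      (ENNReal.coe_ne_zero.2 hε.ne')
    rw [← sum_lintegral_rightOp_iterate hα hαβ h0 h1 hF n]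
    exact add_le_add (ENNReal.sum_le_tsum _) hn

lemma lintegral_invariant_mul_inducedOp (hα : 0 < α) (hαβ : α ≤ β) (h0 : 0 < p₁) (h1 : p₁ < 1)
    (hF : Measurable F) {G : ℝ × ℝ → ENNReal} (hGm : Measurable G)
    (hG : ∀ p, G (skewLSV α β p₁ p) = G p) (hfin : ∫⁻ p in unitBox, G p * F p ≠ ⊤) :
    ∫⁻ p in unitBox, G p * inducedOp α β p₁ F p = ∫⁻ p in unitBox, G p * F p := by
  exact (setLIntegral_congr_fun measurableSet_unitBox
    (inducedOp_invariant_mul hα hαβ h0 h1 hG)).symm.trans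
    (lintegral_inducedOp hα hαβ h0 h1 (hGm.mul hF) hfin)

lemma HasDistortion.left_iterate (hα : 0 < α) (hαβ : α ≤ β) (h0 : 0 < p₁) (h1 : p₁ < 1)
    {a b : ℝ} (ha : 0 ≤ a) (hb : 0 ≤ b) (hF : HasDistortion β a b F) (n : ℕ) :
    HasDistortion β a b ((leftOp α β p₁)^[n] F) := by
  induction n with
  | zero => exact hF
  | succ n ih =>
    rw [Function.iterate_succ_apply']
    exact (ih.left hα hαβ h0 h1 ha hb).mono le_rfl
      (mul_le_of_le_one_right hb (max_le h1.le (by linarith)))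

lemma HasDistortion.induced (hα : 0 < α) (hαβ : α ≤ β) (h0 : 0 < p₁) (h1 : p₁ < 1)
    {a b : ℝ} (ha : 0 ≤ a) (hb : 0 ≤ b) (hF : HasDistortion β a b F) :
    HasDistortion β (a * (1 / 2)) (b * max p₁ (1 - p₁)) (inducedOp α β p₁ F) :=
  HasDistortion.tsum fun j =>
    (hF.left_iterate hα hαβ h0 h1 ha hb j).right (hα.trans_le hαβ) h0 h1 ha hb

lemma HasDistortion.right_le (hβ : 0 < β) (h0 : 0 < p₁) (h1 : p₁ < 1)
    {a b : ℝ} (ha : 0 ≤ a) (hb : 0 ≤ b) (hF : HasDistortion β a b F) {p p' : ℝ × ℝ}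
    (hp : p ∈ unitBox) (hp' : p' ∈ unitBox) :
    rightOp p₁ F p ≤ ENNReal.ofReal (Real.exp (a + b) * 2 ^ (β + 1))
      * rightOp p₁ F p' := by
  have key : ∀ c q : ℝ, 0 ≤ c → 0 < q → c + q ≤ 1 →
      branchOp (fun x => (x + 1) / 2) (fun _ => 1 / 2) c q F p ≤
      ENNReal.ofReal (Real.exp (a + b) * 2 ^ (β + 1))
        * branchOp (fun x => (x + 1) / 2) (fun _ => 1 / 2) c q F p' := by
    intro c q hc hq hcq
    have hm := branch_mem (invBranch_right hβ) hq hc hcq hp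
    have hm' := branch_mem (invBranch_right hβ) hq hc hcq hp'
    simp only [branchOp]
    rw [mul_left_comm]
    refine mul_le_mul_right ((hF _ hm _ hm').trans ?_) _
    refine mul_le_mul_left (ENNReal.ofReal_le_ofReal ?_) _
    have b1 : |(p.1 + 1) / 2 - (p'.1 + 1) / 2| ≤ 1 := by
      rw [abs_le]
      constructor <;> linarith [hp.1.1, hp'.1.1, hp.1.2, hp'.1.2]
    have b2 : |c + q * p.2 - (c + q * p'.2)| ≤ 1 := by
      have h2 := hm.2
      have h2' := hm'.2
      simp only at h2 h2'
      rw [abs_le]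
      constructor <;> linarith [h2.1, h2'.1, h2.2, h2'.2]
    have hx0 := hp.1.1
    have hx0' := hp'.1.1
    have b3 : distFactor β ((p.1 + 1) / 2) ((p'.1 + 1) / 2) ≤ 2 ^ (β + 1) := by
      refine max_le (Real.one_le_rpow one_le_two (by linarith)) ?_
      refine Real.rpow_le_rpow (by positivity) ?_ (by linarith)
      rw [div_le_iff₀ (by positivity)]
      linarith [hp'.1.2]
    have b4 : a * |(p.1 + 1) / 2 - (p'.1 + 1) / 2| + b * |c + q * p.2 - (c + q * p'.2)|
        ≤ a + b := add_le_add (mul_le_of_le_one_right ha b1) (mul_le_of_le_one_right hb b2)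
    exact mul_le_mul (Real.exp_le_exp.2 b4) b3 (distFactor_pos _ _ _).le (Real.exp_pos _).le
  unfold rightOp pairOp
  rw [mul_add]
  exact add_le_add (key 0 p₁ le_rfl h0 (by linarith))
    (key p₁ (1 - p₁) h0.le (sub_pos.2 h1) (by linarith))

lemma HasDistortion.induced_le (hα : 0 < α) (hαβ : α ≤ β) (h0 : 0 < p₁) (h1 : p₁ < 1)
    {a b : ℝ} (ha : 0 ≤ a) (hb : 0 ≤ b) (hF : HasDistortion β a b F) {p p' : ℝ × ℝ}
    (hp : p ∈ unitBox) (hp' : p' ∈ unitBox) :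
    inducedOp α β p₁ F p ≤ ENNReal.ofReal (Real.exp (a + b) * 2 ^ (β + 1))
      * inducedOp α β p₁ F p' := by
  unfold inducedOp
  rw [← ENNReal.tsum_mul_left]
  exact ENNReal.tsum_le_tsum fun j =>
    (hF.left_iterate hα hαβ h0 h1 ha hb j).right_le (hα.trans_le hαβ) h0 h1 ha hb hp hp'

/-- A bounded invariant function captures a definite proportion of the mass of every density
with distortion `a + b ≤ 1`. -/
lemma HasDistortion.lintegral_mul_le_of_add_le_one (hα : 0 < α) (hαβ : α ≤ β)
    (h0 : 0 < p₁) (h1 : p₁ < 1)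
    {a b : ℝ} (ha : 0 ≤ a) (hb : 0 ≤ b) (hab : a + b ≤ 1) (hF : HasDistortion β a b F)
    (hFm : Measurable F) (hfin : ∫⁻ p in unitBox, F p ≠ ⊤) {G : ℝ × ℝ → ENNReal}
    (hGm : Measurable G) (hG : ∀ p, G (skewLSV α β p₁ p) = G p) (hG1 : ∀ p, G p ≤ 1) :
    (∫⁻ p in unitBox, G p) * ∫⁻ p in unitBox, F p
      ≤ ENNReal.ofReal (Real.exp 1 * 2 ^ (β + 1)) * ∫⁻ p in unitBox, G p * F p := by
  have hfinG : ∫⁻ p in unitBox, G p * F p ≠ ⊤ :=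
    ne_top_of_le_ne_top hfin (lintegral_mono fun p => mul_le_of_le_one_left' (hG1 p))
  rw [← lintegral_inducedOp hα hαβ h0 h1 hFm hfin,
    ← lintegral_invariant_mul_inducedOp hα hαβ h0 h1 hFm hGm hG hfinG]
  have hQm := measurable_inducedOp (p₁ := p₁) hα hαβ hFm
  have hpt : ∀ p ∈ unitBox, ∫⁻ p in unitBox, inducedOp α β p₁ F p ≤
      ENNReal.ofReal (Real.exp 1 * 2 ^ (β + 1)) * inducedOp α β p₁ F p := by
    intro p hp
    calc ∫⁻ p in unitBox, inducedOp α β p₁ F p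
        ≤ ∫⁻ _ in unitBox, ENNReal.ofReal (Real.exp 1 * 2 ^ (β + 1))
            * inducedOp α β p₁ F p := by
          refine setLIntegral_mono' measurableSet_unitBox fun p' hp' => ?_
          refine (hF.induced_le hα hαβ h0 h1 ha hb hp' hp).trans ?_
          gcongr
      _ = _ := by rw [setLIntegral_const, volume_unitBox, mul_one]
  rw [← lintegral_mul_const _ hGm,
    ← lintegral_const_mul _ (f := fun p => G p * inducedOp α β p₁ F p) (hGm.mul hQm)]
  refine setLIntegral_mono' measurableSet_unitBox fun p hp => ?_
  rw [mul_left_comm]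
  exact mul_le_mul_right (hpt p hp) _

lemma HasDistortion.lintegral_mul_le (hα : 0 < α) (hαβ : α ≤ β)
    (h0 : 0 < p₁) (h1 : p₁ < 1)
    {a b : ℝ} (ha : 0 ≤ a) (hb : 0 ≤ b) (hF : HasDistortion β a b F)
    (hFm : Measurable F) (hfin : ∫⁻ p in unitBox, F p ≠ ⊤) {G : ℝ × ℝ → ENNReal}
    (hGm : Measurable G) (hG : ∀ p, G (skewLSV α β p₁ p) = G p) (hG1 : ∀ p, G p ≤ 1) :
    (∫⁻ p in unitBox, G p) * ∫⁻ p in unitBox, F p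
      ≤ ENNReal.ofReal (Real.exp 1 * 2 ^ (β + 1)) * ∫⁻ p in unitBox, G p * F p := by
  set r := max (1 / 2) (max p₁ (1 - p₁)) with hr
  have hr1 : r < 1 := max_lt (by norm_num) (max_lt h1 (by linarith))
  have hr0 : 0 ≤ r := le_max_of_le_left (by norm_num)
  have hfinG : ∫⁻ p in unitBox, G p * F p ≠ ⊤ :=
    ne_top_of_le_ne_top hfin (lintegral_mono fun p => mul_le_of_le_one_left' (hG1 p))
  have hind : ∀ n : ℕ, Measurable ((inducedOp α β p₁)^[n] F) ∧
      HasDistortion β (a * r ^ n) (b * r ^ n) ((inducedOp α β p₁)^[n] F) ∧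
      ∫⁻ p in unitBox, (inducedOp α β p₁)^[n] F p = ∫⁻ p in unitBox, F p ∧
      ∫⁻ p in unitBox, G p * (inducedOp α β p₁)^[n] F p = ∫⁻ p in unitBox, G p * F p := by
    intro n
    induction n with
    | zero => simpa using ⟨hFm, hF⟩
    | succ n ih =>
      obtain ⟨i1, i2, i3, i4⟩ := ih
      rw [Function.iterate_succ_apply']
      refine ⟨measurable_inducedOp hα hαβ i1, ?_, ?_, ?_⟩
      · refine (i2.induced hα hαβ h0 h1 (by positivity) (by positivity)).mono ?_ ?_
        · rw [pow_succ, ← mul_assoc]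
          gcongr
          exact le_max_left _ _
        · rw [pow_succ, ← mul_assoc]
          gcongr
          exact le_max_right _ _
      · rw [lintegral_inducedOp hα hαβ h0 h1 i1 (by rwa [i3]), i3]
      · rw [lintegral_invariant_mul_inducedOp hα hαβ h0 h1 i1 hGm hG (by rwa [i4]), i4]
  obtain ⟨n, hn⟩ : ∃ n : ℕ, a * r ^ n + b * r ^ n ≤ 1 := by
    have ht : Tendsto (fun n : ℕ => a * r ^ n + b * r ^ n) atTop (𝓝 (a * 0 + b * 0)) := by
      have := tendsto_pow_atTop_nhds_zero_of_lt_one hr0 hr1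
      exact (this.const_mul a).add (this.const_mul b)
    exact (ht.eventually_le_const (by norm_num : a * 0 + b * 0 < 1)).exists
  obtain ⟨i1, i2, i3, i4⟩ := hind n
  have := i2.lintegral_mul_le_of_add_le_one hα hαβ h0 h1 (by positivity) (by positivity)
    hn i1 (by rwa [i3]) hGm hG hG1
  rwa [i3, i4] at this

end Induced

section Ergodicity

lemma one_le_distFactor (β x x' : ℝ) : 1 ≤ distFactor β x x' := le_max_left _ _

lemma HasDistortion.of_lipschitzWith (β : ℝ) {L : NNReal} {ε : ℝ} (hε : 0 < ε)
    {f : ℝ × ℝ → ℝ} (hf : LipschitzWith L f) (hfε : ∀ p, ε ≤ f p) :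
    HasDistortion β (L / ε) (L / ε) (fun p => ENNReal.ofReal (f p)) := by
  intro p hp p' hp'
  rw [← ENNReal.ofReal_mul (by have := distFactor_pos β p.1 p'.1; positivity)]
  apply ENNReal.ofReal_le_ofReal
  have hf0 : 0 < f p' := hε.trans_le (hfε p')
  have hd : dist p p' ≤ |p.1 - p'.1| + |p.2 - p'.2| := by
    rw [Prod.dist_eq, Real.dist_eq, Real.dist_eq]
    exact max_le_add_of_nonneg (abs_nonneg _) (abs_nonneg _)
  have hL : f p ≤ f p' + L * dist p p' := by
    have := hf.dist_le_mul p p'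
    rw [Real.dist_eq] at this
    linarith [le_abs_self (f p - f p')]
  set d := |p.1 - p'.1| + |p.2 - p'.2| with hd'
  have h1 : (L : ℝ) * d ≤ L / ε * d * f p' := by
    have hd0 : 0 ≤ d := by positivity
    calc (L : ℝ) * d = L / ε * d * ε := by field_simp
      _ ≤ L / ε * d * f p' := by gcongr; exact hfε p'
  have h2 : (L : ℝ) * dist p p' ≤ L * d := by gcongr
  calc f p ≤ (L / ε * d + 1) * f p' := by linarith
    _ ≤ Real.exp (L / ε * |p.1 - p'.1| + L / ε * |p.2 - p'.2|) * f p' := by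
        gcongr
        rw [← mul_add]
        exact Real.add_one_le_exp _
    _ ≤ _ := by
        gcongr
        exact le_mul_of_one_le_right (Real.exp_pos _).le (one_le_distFactor _ _ _)

variable {α β p₁ : ℝ}

lemma volume_eq_zero_of_invariant_of_isClosed (hα : 0 < α) (hαβ : α ≤ β) (h0 : 0 < p₁) (h1 : p₁ < 1)
    {A K : Set (ℝ × ℝ)} (hA : MeasurableSet A) (hinv : skewLSV α β p₁ ⁻¹' A = A)
    (hK : IsClosed K) (hKA : K ⊆ Aᶜ) (hKD : volume (K ∩ unitBox) ≠ 0) :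
    volume (A ∩ unitBox) = 0 := by
  set μ : Measure (ℝ × ℝ) := volume.restrict unitBox with hμ
  have : IsProbabilityMeasure μ := ⟨by rw [hμ, Measure.restrict_apply_univ, volume_unitBox]⟩
  have hμA : μ A = volume (A ∩ unitBox) := Measure.restrict_apply hA
  have hμK : μ K = volume (K ∩ unitBox) := Measure.restrict_apply hK.measurableSet
  rw [← hμA]
  rw [← hμK] at hKD
  have hδ : ∀ n : ℕ, (0 : ℝ) < 1 / ((n : ℝ) + 1) := fun n => by positivity
  have hlim := tendsto_one_div_add_atTop_nhds_zero_nat (𝕜 := ℝ)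
  set C := ENNReal.ofReal (Real.exp 1 * 2 ^ (β + 1))
  have hkey : ∀ n : ℕ, μ A * μ K ≤ C * (ENNReal.ofReal (1 / ((n : ℝ) + 1)) +
      ∫⁻ p, (thickenedIndicator (hδ n) K p : ENNReal) ∂(μ.restrict A)) := by
    intro n
    set t := thickenedIndicator (hδ n) K
    have hF : ∀ p, ENNReal.ofReal (1 / ((n : ℝ) + 1) + (t p : ℝ))
        = ENNReal.ofReal (1 / ((n : ℝ) + 1)) + (t p : ENNReal) := fun p => by
      rw [ENNReal.ofReal_add (hδ n).le (by positivity), ENNReal.ofReal_coe_nnreal]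
    have htm : Measurable fun p => (t p : ENNReal) := t.continuous.measurable.coe_nnreal_ennreal
    have hlip : LipschitzWith (1 / ((n : ℝ) + 1)).toNNReal⁻¹
        (fun p => 1 / ((n : ℝ) + 1) + (t p : ℝ)) := by
      refine LipschitzWith.of_dist_le_mul fun p q => ?_
      have := (lipschitzWith_thickenedIndicator (hδ n) K).dist_le_mul p q
      rw [dist_add_left]
      exact this
    have hdist := HasDistortion.of_lipschitzWith β (hδ n) hlip
      (fun p => le_add_of_nonneg_right (by positivity))
    have hle1 : ∀ p, (t p : ENNReal) ≤ 1 := fun p =>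
      ENNReal.coe_le_one_iff.2 (thickenedIndicator_le_one (hδ n) K p)
    have hmain := hdist.lintegral_mul_le hα hαβ h0 h1 (by positivity) (by positivity)
      (by simp only [hF]; exact measurable_const.add htm)
      (by
        simp only [hF]
        refine ne_top_of_le_ne_top (b := ENNReal.ofReal (1 / ((n : ℝ) + 1)) + 1) (by finiteness) ?_
        calc _ ≤ ∫⁻ p in unitBox, ENNReal.ofReal (1 / ((n : ℝ) + 1)) + 1 :=
              lintegral_mono fun p => by gcongr; exact hle1 p
          _ = _ := by simp)
      (G := A.indicator 1) (measurable_one.indicator hA)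
      (fun p => by
        change (skewLSV α β p₁ ⁻¹' A).indicator 1 p = _
        rw [hinv])
      (fun p => indicator_le_self' (fun _ _ => zero_le) p)
    rw [lintegral_indicator_one hA] at hmain
    simp only [hF] at hmain
    refine (le_trans ?_ hmain).trans ?_
    · gcongr
      rw [← lintegral_indicator_one hK.measurableSet]
      refine lintegral_mono fun p => ?_
      by_cases hp : p ∈ K
      · simp only [indicator_of_mem hp, t, thickenedIndicator_one (hδ n) K hp]
        simp
      · simp [hp]
    · gcongr
      have hrw : ∀ p, A.indicator (1 : ℝ × ℝ → ENNReal) p *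
          (ENNReal.ofReal (1 / ((n : ℝ) + 1)) + (t p : ENNReal))
          = A.indicator (fun p => ENNReal.ofReal (1 / ((n : ℝ) + 1)) + (t p : ENNReal)) p := by
        intro p
        by_cases hp : p ∈ A <;> simp [hp]
      simp only [hrw]
      rw [lintegral_indicator hA, lintegral_add_left measurable_const]
      gcongr
      simp only [lintegral_const, Measure.restrict_apply_univ]
      exact mul_le_of_le_one_right' prob_le_one
  have hz : μ.restrict A K = 0 := by
    rw [Measure.restrict_apply hK.measurableSet, (disjoint_left.2 hKA).inter_eq]
    exact measure_empty
  have htend := (tendsto_lintegral_thickenedIndicator_of_isClosed (μ.restrict A) hK hδ hlim)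
  have hε : Tendsto (fun n : ℕ => ENNReal.ofReal (1 / ((n : ℝ) + 1))) atTop (𝓝 0) := by
    simpa using ENNReal.tendsto_ofReal hlim
  have hC := ENNReal.Tendsto.const_mul (a := C) (hε.add htend) (Or.inr ENNReal.ofReal_ne_top)
  rw [hz, add_zero, mul_zero] at hC
  have := ge_of_tendsto' hC hkey
  exact (mul_eq_zero.1 (nonpos_iff_eq_zero.1 this)).resolve_right hKD

lemma volume_eq_zero_or_of_invariant (hα : 0 < α) (hαβ : α ≤ β) (h0 : 0 < p₁) (h1 : p₁ < 1)
    {A : Set (ℝ × ℝ)} (hA : MeasurableSet A) (hinv : skewLSV α β p₁ ⁻¹' A = A) :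
    volume (A ∩ unitBox) = 0 ∨ volume (Aᶜ ∩ unitBox) = 0 := by
  by_contra! h
  obtain ⟨K, hKs, hK, hpos⟩ := (hA.compl.inter measurableSet_unitBox).exists_lt_isCompact
    (pos_iff_ne_zero.2 h.2)
  refine h.1 (volume_eq_zero_of_invariant_of_isClosed hα hαβ h0 h1 hA hinv hK.isClosed
    (hKs.trans inter_subset_left) ?_)
  rw [inter_eq_left.2 (hKs.trans inter_subset_right)]
  exact hpos.ne'

end Ergodicity

section InvariantDensity

variable {α β p₁ : ℝ} {F : ℝ × ℝ → ENNReal}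

lemma HasDistortion.le_mul (hF : HasDistortion β 0 0 F) {p p' : ℝ × ℝ} (hp : p ∈ unitBox)
    (hp' : p' ∈ unitBox) : F p ≤ ENNReal.ofReal (distFactor β p.1 p'.1) * F p' := by
  simpa using hF p hp p' hp'

lemma HasDistortion.le_of_le (hF : HasDistortion β 0 0 F) (hβ : 0 < β) {p p' : ℝ × ℝ}
    (hp : p ∈ unitBox) (hp' : p' ∈ unitBox) (h : p'.1 ≤ p.1) : F p ≤ F p' := by
  have := hF.le_mul hp hp'
  rwa [distFactor_of_ge hβ hp'.1.1 h, ENNReal.ofReal_one, one_mul] at this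

lemma HasDistortion.one : HasDistortion β 0 0 (fun _ => 1) := by
  intro p hp p' hp'
  simpa using one_le_distFactor _ _ _

lemma HasDistortion.sum {Φ : ℕ → ℝ × ℝ → ENNReal} (s : Finset ℕ)
    (h : ∀ k, HasDistortion β 0 0 (Φ k)) : HasDistortion β 0 0 (fun p => ∑ k ∈ s, Φ k p) := by
  intro p hp p' hp'
  rw [Finset.mul_sum]
  exact Finset.sum_le_sum fun k _ => h k p hp p' hp'

lemma HasDistortion.const_mul (c : ENNReal) (h : HasDistortion β 0 0 F) :
    HasDistortion β 0 0 (fun p => c * F p) := by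
  intro p hp p' hp'
  rw [mul_left_comm]
  exact mul_le_mul_right (h p hp p' hp') c

lemma HasDistortion.of_tendsto {ι : Type*} {l : Filter ι} [l.NeBot] {Φ : ι → ℝ × ℝ → ENNReal}
    (hΦ : ∀ i, HasDistortion β 0 0 (Φ i)) (h : ∀ p, Tendsto (fun i => Φ i p) l (𝓝 (F p))) :
    HasDistortion β 0 0 F := by
  intro p hp p' hp'
  exact le_of_tendsto_of_tendsto' (h p)
    (ENNReal.Tendsto.const_mul (h p') (Or.inr ENNReal.ofReal_ne_top)) fun i => hΦ i _ hp _ hp'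

/-- Normalized densities with the regularity and the growth at the neutral fixed point preserved
by the transfer operator. -/
structure RegularDensity (β : ℝ) (F : ℝ × ℝ → ENNReal) : Prop where
  measurable : Measurable F
  distortion : HasDistortion β 0 0 F
  lintegral_eq : ∫⁻ p in unitBox, F p = 1
  le_rpow : ∀ p ∈ unitBox, F p ≤ ENNReal.ofReal (6 / (1 - β) * p.1 ^ (-β))

lemma one_mem_unitBox : ((1 : ℝ), (0 : ℝ)) ∈ unitBox := by
  constructor <;> norm_num

lemma RegularDensity.one (hβ0 : 0 < β) (hβ : β < 1) : RegularDensity β (fun _ => 1) where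
  measurable := measurable_const
  distortion := HasDistortion.one
  lintegral_eq := by simp [volume_unitBox]
  le_rpow p hp := by
    rw [ENNReal.one_le_ofReal]
    have h1 : 1 ≤ p.1 ^ (-β) :=
      Real.one_le_rpow_of_pos_of_le_one_of_nonpos hp.1.1 hp.1.2 (by linarith)
    have h2 : 1 ≤ 6 / (1 - β) := by
      rw [le_div_iff₀ (by linarith)]
      linarith
    exact one_le_mul_of_one_le_of_one_le h2 h1

lemma RegularDensity.le_of_half_le (hF : RegularDensity β F) (hβ0 : 0 < β) {p : ℝ × ℝ}
    (hp : p ∈ unitBox) (h : 1 / 2 ≤ p.1) : F p ≤ ENNReal.ofReal (2 ^ (β + 1)) := by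
  have hle : ∀ p' ∈ unitBox, F p ≤ ENNReal.ofReal (2 ^ (β + 1)) * F p' := by
    intro p' hp'
    refine (hF.distortion.le_mul hp hp').trans ?_
    gcongr
    refine max_le (Real.one_le_rpow (by norm_num) (by linarith)) ?_
    refine Real.rpow_le_rpow (div_nonneg hp'.1.1.le hp.1.1.le) ?_ (by linarith)
    rw [div_le_iff₀ hp.1.1]
    linarith [hp'.1.2]
  calc F p = ∫⁻ _ in unitBox, F p := by simp [volume_unitBox]
    _ ≤ ∫⁻ p' in unitBox, ENNReal.ofReal (2 ^ (β + 1)) * F p' :=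
        setLIntegral_mono' measurableSet_unitBox hle
    _ = ENNReal.ofReal (2 ^ (β + 1)) := by
        rw [lintegral_const_mul _ hF.measurable, hF.lintegral_eq, mul_one]

lemma RegularDensity.branchOp_left_add_branchOp_right_le (hF : RegularDensity β F) {a c q : ℝ}
    (ha : 0 < a) (hab : a ≤ β) (hβ : β < 1) (hq : 0 < q) (hc : 0 ≤ c) (hcq : c + q ≤ 1)
    {p : ℝ × ℝ} (hp : p ∈ unitBox) :
    branchOp (leftInv a) (leftWeight a) c q F p
      + branchOp (fun x => (x + 1) / 2) (fun _ => 1 / 2) c q F p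
      ≤ ENNReal.ofReal (q * (6 / (1 - β) * p.1 ^ (-β))) := by
  have hβ0 : 0 < β := ha.trans_le hab
  have hw := leftWeight_nonneg ha hp.1
  have hu := (leftInv_mem ha hp.1).1
  have hA : 0 < 6 / (1 - β) := div_pos (by norm_num) (by linarith)
  have hl := hF.le_rpow _ (branch_mem (invBranch_left ha hab) hq hc hcq hp)
  have hr := hF.le_of_half_le hβ0 (branch_mem (invBranch_right hβ0) hq hc hcq hp)
    (by simp only; linarith [hp.1.1])
  calc branchOp (leftInv a) (leftWeight a) c q F p
      + branchOp (fun x => (x + 1) / 2) (fun _ => 1 / 2) c q F p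
      ≤ ENNReal.ofReal (q * leftWeight a p.1) * ENNReal.ofReal (6 / (1 - β) * leftInv a p.1 ^ (-β))
        + ENNReal.ofReal (q * (1 / 2)) * ENNReal.ofReal (2 ^ (β + 1)) := by
        unfold branchOp
        gcongr
    _ = ENNReal.ofReal (q * (leftWeight a p.1 * (6 / (1 - β) * leftInv a p.1 ^ (-β)) + 2 ^ β)) := by
        have : (2 : ℝ) ^ (β + 1) = 2 ^ β * 2 := by
          rw [Real.rpow_add (by norm_num), Real.rpow_one]
        rw [← ENNReal.ofReal_mul (by positivity), ← ENNReal.ofReal_mul (by positivity),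
          ← ENNReal.ofReal_add (by positivity) (by positivity), this]
        congr 1
        ring
    _ ≤ _ := by
        gcongr
        exact power_bound_step ha hab hβ hp.1

lemma RegularDensity.transferOp (hF : RegularDensity β F) (hα : 0 < α) (hαβ : α ≤ β) (hβ : β < 1)
    (h0 : 0 < p₁) (h1 : p₁ < 1) : RegularDensity β (transferOp α β p₁ F) where
  measurable := (measurable_leftOp hα hαβ hF.measurable).add (measurable_rightOp hF.measurable)
  distortion := ((hF.distortion.left hα hαβ h0 h1 le_rfl le_rfl).mono le_rfl (by simp)).add
    ((hF.distortion.right (hα.trans_le hαβ) h0 h1 le_rfl le_rfl).mono (by simp) (by simp))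
  lintegral_eq := by rw [lintegral_transferOp hα hαβ h0 h1 hF.measurable, hF.lintegral_eq]
  le_rpow p hp := by
    have i1 := hF.branchOp_left_add_branchOp_right_le hα hαβ hβ h0 le_rfl (by linarith) hp
    have i2 := hF.branchOp_left_add_branchOp_right_le (hα.trans_le hαβ) le_rfl hβ
      (sub_pos.2 h1) h0.le (by linarith) hp
    have hx := Real.rpow_nonneg hp.1.1.le (-β)
    have hA : 0 < 6 / (1 - β) := div_pos (by norm_num) (by linarith)
    have h1' : 0 ≤ 1 - p₁ := by linarith
    calc _root_.transferOp α β p₁ F p = _ := by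
            simp only [_root_.transferOp, leftOp, rightOp, pairOp]
            exact add_add_add_comm _ _ _ _
      _ ≤ _ := add_le_add i1 i2
      _ = _ := by
        rw [← ENNReal.ofReal_add (by positivity) (by positivity)]
        congr 1
        ring

lemma RegularDensity.iterate (hα : 0 < α) (hαβ : α ≤ β) (hβ : β < 1)
    (h0 : 0 < p₁) (h1 : p₁ < 1) (n : ℕ) :
    RegularDensity β ((_root_.transferOp α β p₁)^[n] fun _ => 1) := by
  induction n with
  | zero => exact RegularDensity.one (hα.trans_le hαβ) hβ
  | succ n ih =>
    rw [Function.iterate_succ_apply']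
    exact ih.transferOp hα hαβ hβ h0 h1

lemma lintegral_rpow_ne_top (hβ : β < 1) (A : ℝ) :
    ∫⁻ p in unitBox, ENNReal.ofReal (A * p.1 ^ (-β)) ≠ ⊤ := by
  have h := intervalIntegral.intervalIntegrable_rpow' (a := 0) (b := 1) (r := -β) (by linarith)
  rw [intervalIntegrable_iff_integrableOn_Ioc_of_le zero_le_one] at h
  have h2 : Integrable (fun p : ℝ × ℝ => A * p.1 ^ (-β)) (volume.restrict unitBox) := by
    rw [unitBox, Measure.volume_eq_prod, ← Measure.prod_restrict]
    exact (Integrable.const_mul h A).comp_fst _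
  exact h2.lintegral_lt_top.ne

lemma RegularDensity.exists_le_mul (hβ0 : 0 < β) (hβ : β < 1) :
    ∃ C : ENNReal, C ≠ ⊤ ∧ ∀ F, RegularDensity β F → 1 / 2 ≤ C * F (1, 0) := by
  obtain ⟨δ, hδ, h⟩ := exists_strip_lintegral_lt (lintegral_rpow_ne_top hβ (6 / (1 - β)))
    (ε := 1 / 2) (by simp)
  refine ⟨ENNReal.ofReal ((1 / δ) ^ (β + 1)), ENNReal.ofReal_ne_top, fun F hF => ?_⟩
  have hle : ∀ p ∈ unitBox, F p ≤ {p : ℝ × ℝ | p.1 < δ}.indicator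
      (fun p => ENNReal.ofReal (6 / (1 - β) * p.1 ^ (-β))) p
        + ENNReal.ofReal ((1 / δ) ^ (β + 1)) * F (1, 0) := by
    intro p hp
    by_cases hpδ : p.1 < δ
    · rw [indicator_of_mem (by exact hpδ)]
      exact (hF.le_rpow p hp).trans le_self_add
    · rw [indicator_of_notMem (by exact hpδ), zero_add]
      refine (hF.distortion.le_mul hp one_mem_unitBox).trans ?_
      rw [distFactor_of_le hβ0 hp.1.1 hp.1.2]
      have := hp.1.1
      gcongr
      exact not_lt.1 hpδ
  have hint : (1 : ENNReal) ≤ 1 / 2 + ENNReal.ofReal ((1 / δ) ^ (β + 1)) * F (1, 0) := by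
    calc (1 : ENNReal) = ∫⁻ p in unitBox, F p := hF.lintegral_eq.symm
      _ ≤ _ := setLIntegral_mono' measurableSet_unitBox hle
      _ = _ := by
        rw [lintegral_add_right _ measurable_const, lintegral_const, Measure.restrict_apply_univ,
          volume_unitBox, mul_one]
      _ ≤ _ := by gcongr
  rw [one_div] at hint ⊢
  have h2 : (1 : ENNReal) = 2⁻¹ + 2⁻¹ := ENNReal.inv_two_add_inv_two.symm
  rw [h2] at hint
  exact (ENNReal.add_le_add_iff_left (by simp)).1 hint

lemma tendsto_transferOp (hα : 0 < α) (hαβ : α ≤ β) (h0 : 0 < p₁) (h1 : p₁ < 1)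
    {ι : Type*} {l : Filter ι} {Φ : ι → ℝ × ℝ → ENNReal}
    (h : ∀ p ∈ unitBox, Tendsto (fun i => Φ i p) l (𝓝 (F p))) :
    ∀ p ∈ unitBox, Tendsto (fun i => transferOp α β p₁ (Φ i) p) l
      (𝓝 (transferOp α β p₁ F p)) := fun p hp =>
  (tendsto_pairOp (invBranch_left hα hαβ) (invBranch_left (hα.trans_le hαβ) le_rfl) h0 h1 h p
    hp).add (tendsto_pairOp (invBranch_right one_pos) (invBranch_right one_pos) h0 h1 h p hp)

/-- The Cesàro averages of the iterates of the constant density. -/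
def cesaroDensity (α β p₁ : ℝ) (n : ℕ) (p : ℝ × ℝ) : ENNReal :=
  ((n : ENNReal) + 1)⁻¹ * ∑ k ∈ Finset.range (n + 1), (transferOp α β p₁)^[k] (fun _ => 1) p

lemma transferOp_cesaroDensity (n : ℕ) (p : ℝ × ℝ) :
    transferOp α β p₁ (cesaroDensity α β p₁ n) p + ((n : ENNReal) + 1)⁻¹
      = cesaroDensity α β p₁ n p
        + ((n : ENNReal) + 1)⁻¹ * (transferOp α β p₁)^[n + 1] (fun _ => 1) p := by
  have h : transferOp α β p₁ (cesaroDensity α β p₁ n) p = ((n : ENNReal) + 1)⁻¹ *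
      ∑ k ∈ Finset.range (n + 1), (transferOp α β p₁)^[k + 1] (fun _ => 1) p := by
    simp only [Function.iterate_succ_apply']
    unfold cesaroDensity
    simp only [transferOp, leftOp, rightOp, pairOp_const_mul, pairOp_finset_sum,
      Finset.sum_add_distrib, mul_add]
  rw [h, cesaroDensity, ← mul_add, ← Finset.sum_range_succ,
    Finset.sum_range_succ' (fun k => (transferOp α β p₁)^[k] (fun _ => 1) p), mul_add]
  simp

lemma ENNReal.average_le {n : ℕ} {f : ℕ → ENNReal} {B : ENNReal} (h : ∀ k, f k ≤ B) :
    ((n : ENNReal) + 1)⁻¹ * ∑ k ∈ Finset.range (n + 1), f k ≤ B := by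
  rw [mul_comm, ← div_eq_mul_inv]
  refine ENNReal.div_le_of_le_mul' ?_
  calc _ ≤ ∑ k ∈ Finset.range (n + 1), B := Finset.sum_le_sum fun k _ => h k
    _ = _ := by simp

lemma ENNReal.le_average {n : ℕ} {f : ℕ → ENNReal} {B : ENNReal} (h : ∀ k, B ≤ f k) :
    B ≤ ((n : ENNReal) + 1)⁻¹ * ∑ k ∈ Finset.range (n + 1), f k := by
  rw [mul_comm, ← div_eq_mul_inv, ENNReal.le_div_iff_mul_le (by simp) (Or.inl (by simp))]
  calc B * ((n : ENNReal) + 1) = ∑ k ∈ Finset.range (n + 1), B := by simp [mul_comm]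
    _ ≤ _ := Finset.sum_le_sum fun k _ => h k

lemma exists_invariant_density (hα : 0 < α) (hαβ : α ≤ β) (hβ : β < 1)
    (h0 : 0 < p₁) (h1 : p₁ < 1) :
    ∃ H : ℝ × ℝ → ENNReal, HasDistortion β 0 0 H ∧ H (1, 0) ≠ 0 ∧
      (∀ p ∈ unitBox, H p ≤ ENNReal.ofReal (6 / (1 - β) * p.1 ^ (-β))) ∧
      EqOn (transferOp α β p₁ H) H unitBox := by
  have hβ0 : 0 < β := hα.trans_le hαβ
  have hreg := fun n => RegularDensity.iterate hα hαβ hβ h0 h1 n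
  set U : Ultrafilter ℕ := hyperfilter ℕ
  set A := cesaroDensity α β p₁
  have hlim : ∀ p, ∃ y, Tendsto (fun n => A n p) U (𝓝 y) := fun p =>
    ⟨(U.map fun n => A n p).lim, (U.map fun n => A n p).le_nhds_lim⟩
  choose H hH using hlim
  have hAle : ∀ n, ∀ p ∈ unitBox, A n p ≤ ENNReal.ofReal (6 / (1 - β) * p.1 ^ (-β)) :=
    fun n p hp => ENNReal.average_le fun k => (hreg k).le_rpow p hp
  refine ⟨H, ?_, ?_, ?_, ?_⟩
  · exact HasDistortion.of_tendsto
      (fun n => (HasDistortion.sum _ fun k => (hreg k).distortion).const_mul _) hH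
  · obtain ⟨C, hC, hle⟩ := RegularDensity.exists_le_mul hβ0 hβ
    have : 1 / 2 ≤ C * H (1, 0) := by
      refine ge_of_tendsto' (ENNReal.Tendsto.const_mul (hH (1, 0)) (Or.inr hC)) fun n => ?_
      change 1 / 2 ≤ C * (_ * ∑ _ ∈ _, _)
      rw [mul_left_comm, Finset.mul_sum]
      exact ENNReal.le_average fun k => hle _ (hreg k)
    rintro hz
    simp [hz] at this
  · exact fun p hp => le_of_tendsto' (hH p) fun n => hAle n p hp
  · intro p hp
    have hinv : Tendsto (fun n : ℕ => ((n : ENNReal) + 1)⁻¹) U (𝓝 0) := by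
      have h := (ENNReal.tendsto_inv_nat_nhds_zero.comp (tendsto_add_atTop_nat 1)).mono_left
        Nat.hyperfilter_le_atTop
      simpa [Function.comp_def] using h
    have hL := (tendsto_transferOp hα hαβ h0 h1 (fun p _ => hH p) p hp).add hinv
    have hR : Tendsto (fun n => A n p + ((n : ENNReal) + 1)⁻¹ *
        (transferOp α β p₁)^[n + 1] (fun _ => 1) p) U (𝓝 (H p + 0)) := by
      refine (hH p).add ?_
      have hb : Tendsto (fun n : ℕ => ((n : ENNReal) + 1)⁻¹ *
          ENNReal.ofReal (6 / (1 - β) * p.1 ^ (-β))) U (𝓝 0) := by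
        simpa using ENNReal.Tendsto.mul_const hinv
          (Or.inr (ENNReal.ofReal_ne_top (r := 6 / (1 - β) * p.1 ^ (-β))))
      refine tendsto_of_tendsto_of_tendsto_of_le_of_le tendsto_const_nhds hb
        (fun _ => zero_le) fun n => ?_
      dsimp only
      gcongr
      exact (hreg (n + 1)).le_rpow p hp
    have := tendsto_nhds_unique hL (hR.congr fun n => (transferOp_cesaroDensity n p).symm)
    simpa using this

end InvariantDensity

section Conclusion

variable {α β p₁ : ℝ} {g : ℝ → ℝ}

/-- Positive decreasing functions on `(0, 1]` with polynomially controlled decay. -/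
structure DensityProfile (β : ℝ) (g : ℝ → ℝ) : Prop where
  pos : ∀ x ∈ Ioc (0 : ℝ) 1, 0 < g x
  antitoneOn : AntitoneOn g (Ioc 0 1)
  le_mul : ∀ x ∈ Ioc (0 : ℝ) 1, ∀ y ∈ Ioc (0 : ℝ) 1, x ≤ y → g x ≤ (y / x) ^ (β + 1) * g y

lemma DensityProfile.const_mul (hg : DensityProfile β g) {c : ℝ} (hc : 0 < c) :
    DensityProfile β (fun x => c * g x) where
  pos x hx := mul_pos hc (hg.pos x hx)
  antitoneOn := fun x hx y hy hxy => mul_le_mul_of_nonneg_left (hg.antitoneOn hx hy hxy) hc.le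
  le_mul x hx y hy hxy := by
    rw [mul_left_comm]
    exact mul_le_mul_of_nonneg_left (hg.le_mul x hx y hy hxy) hc.le

lemma DensityProfile.congr {g' : ℝ → ℝ} (hg : DensityProfile β g) (h : EqOn g' g (Ioc 0 1)) :
    DensityProfile β g' where
  pos x hx := by rw [h hx]; exact hg.pos x hx
  antitoneOn := hg.antitoneOn.congr h.symm
  le_mul x hx y hy hxy := by rw [h hx, h hy]; exact hg.le_mul x hx y hy hxy

lemma DensityProfile.lipschitzOnWith (hg : DensityProfile β g) (hβ : β ≤ 1) {ε : ℝ} (hε : 0 < ε)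
    (hε1 : ε ≤ 1) : LipschitzOnWith (2 * g ε / ε).toNNReal g (Icc ε 1) := by
  have hgε := hg.pos ε ⟨hε, hε1⟩
  refine LipschitzOnWith.of_dist_le_mul fun x hx y hy => ?_
  rw [Real.coe_toNNReal _ (by positivity)]
  wlog hxy : x ≤ y generalizing x y
  · rw [dist_comm, dist_comm x y]
    exact this y hy x hx (le_of_not_ge hxy)
  have hx0 : 0 < x := hε.trans_le hx.1
  have hy0 : 0 < y := hε.trans_le hy.1
  have hxm : x ∈ Ioc (0 : ℝ) 1 := ⟨hx0, hx.2⟩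
  have hym : y ∈ Ioc (0 : ℝ) 1 := ⟨hy0, hy.2⟩
  have hanti := hg.antitoneOn hxm hym hxy
  rw [Real.dist_eq, Real.dist_eq, abs_of_nonneg (sub_nonneg.2 hanti), abs_sub_comm,
    abs_of_nonneg (sub_nonneg.2 hxy)]
  have hsq : g x ≤ (y / x) ^ 2 * g y := by
    refine (hg.le_mul x hxm y hym hxy).trans ?_
    gcongr
    · exact (hg.pos y hym).le
    · rw [← Real.rpow_natCast]
      exact Real.rpow_le_rpow_of_exponent_le ((one_le_div hx0).2 hxy)
        (by push_cast; linarith)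
  rw [div_pow, div_mul_eq_mul_div, le_div_iff₀ (by positivity)] at hsq
  have hgx : g x ≤ g ε := hg.antitoneOn ⟨hε, hε1⟩ hxm hx.1
  have hgx0 := hg.pos x hxm
  have hlin : (g x - g y) * y ≤ 2 * g x * (y - x) := by
    have hsq2 : (g x - g y) * y * y ≤ 2 * g x * (y - x) * y := by
      nlinarith [mul_nonneg hgx0.le (sq_nonneg (y - x))]
    exact le_of_mul_le_mul_right hsq2 hy0
  have hxy0 : 0 ≤ y - x := sub_nonneg.2 hxy
  calc g x - g y ≤ 2 * g x * (y - x) / y := by rwa [le_div_iff₀ hy0]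
    _ ≤ 2 * g ε * (y - x) / ε := by
        gcongr
        exact hy.1
    _ = 2 * g ε / ε * (y - x) := by ring

lemma DensityProfile.continuousOn (hg : DensityProfile β g) (hβ : β ≤ 1) :
    ContinuousOn g (Ioc 0 1) := by
  intro x hx
  have h := (hg.lipschitzOnWith hβ (half_pos hx.1) (by linarith [hx.2])).continuousOn x
    ⟨by linarith [hx.1], hx.2⟩
  refine h.mono_of_mem_nhdsWithin ?_
  filter_upwards [self_mem_nhdsWithin,
    mem_nhdsWithin_of_mem_nhds (Ioi_mem_nhds (half_lt_self hx.1))] with y hy hy'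
  exact ⟨le_of_lt hy', hy.2⟩

lemma exists_densityProfile (hα : 0 < α) (hαβ : α ≤ β) (hβ : β < 1) (h0 : 0 < p₁) (h1 : p₁ < 1) :
    ∃ g : ℝ → ℝ, DensityProfile β g ∧ Measurable g ∧
      ∫⁻ p in unitBox, ENNReal.ofReal (g p.1) = 1 ∧
      EqOn (transferOp α β p₁ fun p => ENNReal.ofReal (g p.1))
        (fun p => ENNReal.ofReal (g p.1)) unitBox := by
  have hβ0 : 0 < β := hα.trans_le hαβ
  obtain ⟨H, hH, hH0, hHle, hHinv⟩ := exists_invariant_density hα hαβ hβ h0 h1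
  have hmem : ∀ x ∈ Ioc (0 : ℝ) 1, (x, (0 : ℝ)) ∈ unitBox := fun x hx => ⟨hx, by simp⟩
  have hHtop : ∀ p ∈ unitBox, H p ≠ ⊤ := fun p hp =>
    ne_top_of_le_ne_top ENNReal.ofReal_ne_top (hHle p hp)
  set g₀ : ℝ → ℝ := (Ioc (0 : ℝ) 1).piecewise (fun x => (H (x, 0)).toReal) 0 with hg₀
  have hg₀_eq : EqOn g₀ (fun x => (H (x, 0)).toReal) (Ioc 0 1) := piecewise_eqOn _ _ _
  have hprof' : DensityProfile β (fun x => (H (x, 0)).toReal) := by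
    refine ⟨fun x hx => ?_, fun x hx y hy hxy => ?_, fun x hx y hy hxy => ?_⟩
    · refine ENNReal.toReal_pos ?_ (hHtop _ (hmem x hx))
      refine ((pos_iff_ne_zero.2 hH0).trans_le ?_).ne'
      exact hH.le_of_le hβ0 one_mem_unitBox (hmem x hx) hx.2
    · exact ENNReal.toReal_mono (hHtop _ (hmem x hx)) (hH.le_of_le hβ0 (hmem y hy) (hmem x hx) hxy)
    · have := hH.le_mul (hmem x hx) (hmem y hy)
      rw [distFactor_of_le hβ0 hx.1 hxy] at this
      have h' := ENNReal.toReal_mono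
        (ENNReal.mul_ne_top ENNReal.ofReal_ne_top (hHtop _ (hmem y hy))) this
      rwa [ENNReal.toReal_mul,
        ENNReal.toReal_ofReal (Real.rpow_nonneg (div_nonneg hy.1.le hx.1.le) _)] at h'
  have hprof := hprof'.congr hg₀_eq
  have hg₀m : Measurable g₀ :=
    (hprof'.continuousOn hβ.le).measurable_piecewise continuousOn_const measurableSet_Ioc
  have hgH : EqOn (fun p : ℝ × ℝ => ENNReal.ofReal (g₀ p.1)) H unitBox := by
    intro p hp
    have hm := hmem p.1 hp.1
    simp only
    rw [hg₀_eq hp.1, ENNReal.ofReal_toReal (hHtop _ hm)]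
    exact le_antisymm (hH.le_of_le hβ0 hm hp le_rfl) (hH.le_of_le hβ0 hp hm le_rfl)
  set Z := ∫⁻ p in unitBox, ENNReal.ofReal (g₀ p.1) with hZ
  have hGm : Measurable fun p : ℝ × ℝ => ENNReal.ofReal (g₀ p.1) := by fun_prop
  have hZtop : Z ≠ ⊤ := by
    refine ne_top_of_le_ne_top (lintegral_rpow_ne_top hβ (6 / (1 - β))) ?_
    refine setLIntegral_mono' measurableSet_unitBox fun p hp => ?_
    exact (hgH hp).le.trans (hHle p hp)
  have hZ0 : Z ≠ 0 := by
    rw [hZ, Ne, lintegral_eq_zero_iff hGm]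
    intro h
    have : ∀ᵐ p ∂(volume.restrict unitBox), False := by
      filter_upwards [h, ae_restrict_mem measurableSet_unitBox] with p hp hpm
      have := hprof.pos p.1 hpm.1
      simp only [Pi.zero_apply, ENNReal.ofReal_eq_zero] at hp
      linarith
    rw [eventually_false_iff_eq_bot, ae_eq_bot, Measure.restrict_eq_zero, volume_unitBox] at this
    exact one_ne_zero this
  have hc : 0 < Z.toReal⁻¹ := inv_pos.2 (ENNReal.toReal_pos hZ0 hZtop)
  have hmul : ∀ x, ENNReal.ofReal (Z.toReal⁻¹ * g₀ x) = Z⁻¹ * ENNReal.ofReal (g₀ x) := fun x => by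
    rw [ENNReal.ofReal_mul hc.le, ENNReal.ofReal_inv_of_pos (ENNReal.toReal_pos hZ0 hZtop),
      ENNReal.ofReal_toReal hZtop]
  refine ⟨fun x => Z.toReal⁻¹ * g₀ x, hprof.const_mul hc, hg₀m.const_mul _, ?_, ?_⟩
  · simp only [hmul]
    rw [lintegral_const_mul _ hGm]
    exact ENNReal.inv_mul_cancel hZ0 hZtop
  · intro p hp
    have hinv : transferOp α β p₁ (fun p => ENNReal.ofReal (g₀ p.1)) p
        = ENNReal.ofReal (g₀ p.1) :=
      (congrArg₂ (· + ·) (leftOp_congr hα hαβ h0 h1 hgH hp) (rightOp_congr h0 h1 hgH hp)).trans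
        ((hHinv hp).trans (hgH hp).symm)
    simp only [hmul]
    rw [← hinv]
    simp only [transferOp, leftOp, rightOp, pairOp_const_mul, mul_add]

lemma unitBox_ae_eq : unitBox =ᵐ[volume] (Ioc (0 : ℝ) 1 ×ˢ Icc (0 : ℝ) 1 : Set (ℝ × ℝ)) :=
  Measure.set_prod_ae_eq EventuallyEq.rfl Ico_ae_eq_Icc

lemma square_ae_eq :
    (Icc (0 : ℝ) 1 ×ˢ Icc (0 : ℝ) 1 : Set (ℝ × ℝ)) =ᵐ[volume] unitBox :=
  Measure.set_prod_ae_eq Ioc_ae_eq_Icc.symm Ico_ae_eq_Icc.symm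

lemma absolutelyContinuous_restrict_unitBox {ν : Measure (ℝ × ℝ)} (hν : ν ≪ volume)
    (hs : ν ((Icc (0 : ℝ) 1 ×ˢ Icc (0 : ℝ) 1)ᶜ) = 0) : ν ≪ volume.restrict unitBox := by
  have h : ν.restrict (Icc (0 : ℝ) 1 ×ˢ Icc (0 : ℝ) 1) = ν :=
    Measure.restrict_eq_self_of_ae_mem hs
  rw [← h, ← Measure.restrict_congr_set square_ae_eq]
  exact hν.restrict _

lemma measurePreserving_withDensity (hα : 0 < α) (hαβ : α ≤ β) (h0 : 0 < p₁) (h1 : p₁ < 1)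
    {F : ℝ × ℝ → ENNReal} (hF : Measurable F) (hinv : EqOn (transferOp α β p₁ F) F unitBox) :
    MeasurePreserving (skewLSV α β p₁) ((volume.restrict unitBox).withDensity F)
      ((volume.restrict unitBox).withDensity F) := by
  refine ⟨measurable_skewLSV, ?_⟩
  have happ : ∀ A : Set (ℝ × ℝ), MeasurableSet A →
      (volume.restrict unitBox).withDensity F A
        = ∫⁻ p in unitBox, A.indicator (1 : ℝ × ℝ → ENNReal) p * F p := by
    intro A hA
    rw [withDensity_apply _ hA, ← lintegral_indicator hA]
    congr 1 with p
    by_cases hp : p ∈ A <;> simp [hp]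
  ext A hA
  rw [Measure.map_apply measurable_skewLSV hA, happ _ (measurable_skewLSV hA), happ A hA]
  have hm : Measurable fun p => A.indicator (1 : ℝ × ℝ → ENNReal) (skewLSV α β p₁ p) * F p :=
    ((measurable_one.indicator hA).comp measurable_skewLSV).mul hF
  refine (lintegral_transferOp hα hαβ h0 h1 hm).symm.trans ?_
  refine setLIntegral_congr_fun measurableSet_unitBox fun p hp => ?_
  rw [transferOp, leftOp_comp_mul hα (hα.trans_le hαβ) h0 h1 F _ hp,
    rightOp_comp_mul α β h0 h1 F _ hp, ← mul_add]
  congr 1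
  exact hinv hp

lemma preErgodic_of_absolutelyContinuous (hα : 0 < α) (hαβ : α ≤ β) (h0 : 0 < p₁) (h1 : p₁ < 1)
    {ν : Measure (ℝ × ℝ)} (hν : ν ≪ volume.restrict unitBox) :
    PreErgodic (skewLSV α β p₁) ν := by
  refine ⟨fun A hA hinv => ?_⟩
  rw [eventuallyConst_set']
  rcases volume_eq_zero_or_of_invariant hα hαβ h0 h1 hA hinv with h | h
  · left
    rw [← Measure.restrict_apply hA] at h
    exact ae_eq_empty.2 (hν h)
  · right
    rw [← Measure.restrict_apply hA.compl] at h
    exact eventuallyEq_univ.2 (hν h)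

lemma DensityProfile.exists_lipschitzOnWith_indicator (hg : DensityProfile β g) (hβ : β ≤ 1)
    {K : Set (ℝ × ℝ)} (hKs : K ⊆ Ioc (0 : ℝ) 1 ×ˢ Icc (0 : ℝ) 1) (hK : IsCompact K) :
    ∃ L : NNReal, LipschitzOnWith L
      ((Ioc (0 : ℝ) 1 ×ˢ Icc (0 : ℝ) 1).indicator fun p => g p.1) K := by
  rcases K.eq_empty_or_nonempty with rfl | hne
  · exact ⟨0, lipschitzOnWith_empty _ _⟩
  obtain ⟨q, hq, hmin⟩ := hK.exists_isMinOn hne continuous_fst.continuousOn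
  have hqm := (hKs hq).1
  refine ⟨(2 * g q.1 / q.1).toNNReal * 1, ?_⟩
  have h := (hg.lipschitzOnWith hβ hqm.1 hqm.2).comp
    (LipschitzWith.prod_fst.lipschitzOnWith (s := K)) (fun p hp => ⟨hmin hp, (hKs hp).1.2⟩)
  intro x hx y hy
  rw [indicator_of_mem (hKs hx), indicator_of_mem (hKs hy)]
  exact h hx hy

end Conclusion

/-- Theorem 1.2 (1) and Lemma 3.1: unique absolutely continuous
`S`-invariant probability measure, with density Lipschitz on compact subsets of
`(0,1] × [0,1]`. -/
theorem exists_unique_acip (α β p₁ : ℝ) (hα : 0 < α) (hαβ : α < β) (hβ : β < 1)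
    (hp₁ : 0 < p₁) (hp₁' : p₁ < 1) :
    ∃ ν : Measure (ℝ × ℝ),
      (IsProbabilityMeasure ν ∧ ν ≪ (volume : Measure (ℝ × ℝ)) ∧
        ν ((Icc (0 : ℝ) 1 ×ˢ Icc (0 : ℝ) 1)ᶜ) = 0 ∧
        ∀ A : Set (ℝ × ℝ), MeasurableSet A → ν (skewLSV α β p₁ ⁻¹' A) = ν A) ∧
      (∀ ν' : Measure (ℝ × ℝ),
        (IsProbabilityMeasure ν' ∧ ν' ≪ (volume : Measure (ℝ × ℝ)) ∧
          ν' ((Icc (0 : ℝ) 1 ×ˢ Icc (0 : ℝ) 1)ᶜ) = 0 ∧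
          ∀ A : Set (ℝ × ℝ), MeasurableSet A → ν' (skewLSV α β p₁ ⁻¹' A) = ν' A) → ν' = ν) ∧
      ∃ h : ℝ × ℝ → ℝ,
        ν = volume.withDensity (fun p => ENNReal.ofReal (h p)) ∧
        ∀ K : Set (ℝ × ℝ), K ⊆ Ioc (0 : ℝ) 1 ×ˢ Icc (0 : ℝ) 1 → IsCompact K →
          ∃ L : NNReal, LipschitzOnWith L h K := by
  obtain ⟨g, hg, hgm, hg1, hginv⟩ := exists_densityProfile hα hαβ.le hβ hp₁ hp₁'
  have hGm : Measurable fun p : ℝ × ℝ => ENNReal.ofReal (g p.1) := by fun_prop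
  set ν := (volume.restrict unitBox).withDensity fun p : ℝ × ℝ => ENNReal.ofReal (g p.1)
  have hν : ν ≪ volume.restrict unitBox := withDensity_absolutelyContinuous _ _
  have hν' : volume.restrict unitBox ≪ ν := by
    refine withDensity_absolutelyContinuous' hGm.aemeasurable ?_
    filter_upwards [ae_restrict_mem measurableSet_unitBox] with p hp
    exact (ENNReal.ofReal_pos.2 (hg.pos _ hp.1)).ne'
  have hprob : IsProbabilityMeasure ν :=
    ⟨by rw [withDensity_apply _ MeasurableSet.univ, Measure.restrict_univ, hg1]⟩
  have hpres := measurePreserving_withDensity hα hαβ.le hp₁ hp₁' hGm hginv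
  have herg : Ergodic (skewLSV α β p₁) ν :=
    ⟨hpres, preErgodic_of_absolutelyContinuous hα hαβ.le hp₁ hp₁' hν⟩
  refine ⟨ν, ⟨hprob, hν.trans Measure.restrict_le_self.absolutelyContinuous, ?_,
    fun A hA => hpres.measure_preimage hA.nullMeasurableSet⟩, ?_,
    (Ioc (0 : ℝ) 1 ×ˢ Icc (0 : ℝ) 1).indicator fun p => g p.1, ?_,
    fun K hKs hK => hg.exists_lipschitzOnWith_indicator hβ.le hKs hK⟩
  · apply hν
    rw [Measure.restrict_congr_set square_ae_eq.symm,
      Measure.restrict_apply (measurableSet_Icc.prod measurableSet_Icc).compl, compl_inter_self,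
      measure_empty]
  · rintro ν' ⟨hprob', hac, hs, hinv⟩
    have hpres' : MeasurePreserving (skewLSV α β p₁) ν' ν' := ⟨measurable_skewLSV, by
      ext A hA
      rw [Measure.map_apply measurable_skewLSV hA, hinv A hA]⟩
    exact herg.eq_of_absolutelyContinuous hpres'
      ((absolutelyContinuous_restrict_unitBox hac hs).trans hν')
  · have : (fun p : ℝ × ℝ => ENNReal.ofReal
        ((Ioc (0 : ℝ) 1 ×ˢ Icc (0 : ℝ) 1).indicator (fun p => g p.1) p))
        = (Ioc (0 : ℝ) 1 ×ˢ Icc (0 : ℝ) 1).indicator fun p => ENNReal.ofReal (g p.1) := by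
      funext p
      by_cases hp : p ∈ Ioc (0 : ℝ) 1 ×ˢ Icc (0 : ℝ) 1
      · rw [indicator_of_mem hp, indicator_of_mem hp]
      · rw [indicator_of_notMem hp, indicator_of_notMem hp, ENNReal.ofReal_zero]
    rw [this, withDensity_indicator (measurableSet_Ioc.prod measurableSet_Icc),
      ← Measure.restrict_congr_set unitBox_ae_eq]
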